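/- Let d ≥ 3 be an integer and N > 0. Then there exist a constant C > 0 and a real-valued function F ∈ C^∞([0,∞)×T^d) with F not identically zero, such that |ΔF(x)| ≤ C·|F(x)| and |F(x)| ≤ C·e^{−N·w^{4/3}} for all x = (w,y) ∈ [0,∞)×T^d. -/

import Mathlib

open Real MeasureTheory

/-- The Laplacian in all `d+1` variables `(w, y)` of a function on `ℝ × ℝ^d`:
`ΔF = ∂²F/∂w² + Σ_j ∂²F/∂y_j²`. -/
noncomputable def cylLaplacian (d : ℕ) (F : ℝ × (Fin d → ℝ) → ℝ)
    (p : ℝ × (Fin d → ℝ)) : ℝ :=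
  deriv (deriv (fun t => F (t, p.2))) p.1 +
    ∑ i : Fin d, deriv (deriv (fun t => F (p.1, Function.update p.2 i t))) (p.2 i)

/-- A function on `ℝ × ℝ^d` is `2π`-periodic in each coordinate of `y`,
i.e. descends to the torus `T^d = ℝ^d/(2πℤ)^d`. -/
def cylPeriodic (d : ℕ) (F : ℝ × (Fin d → ℝ) → ℝ) : Prop :=
  ∀ (p : ℝ × (Fin d → ℝ)) (i : Fin d),
    F (p.1, Function.update p.2 i (p.2 i + 2 * π)) = F p

open Filter Topology

/-- The integral ternary quadratic form with Gram matrix `!![a, d, e; d, b, f; e, f, c]`. -/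
def ternaryForm (a b c d e f x y z : ℤ) : ℤ :=
  a * x ^ 2 + b * y ^ 2 + c * z ^ 2 + 2 * d * x * y + 2 * e * x * z + 2 * f * y * z

lemma exists_shift_abs_le (a d : ℤ) (ha : 0 < a) : ∃ k : ℤ, 2 * |d + k * a| ≤ a := by
  refine ⟨-((2 * d + a) / (2 * a)), ?_⟩
  have h1 := Int.mul_ediv_add_emod (2 * d + a) (2 * a)
  have h2 := Int.emod_nonneg (2 * d + a) (b := 2 * a) (by positivity)
  have h3 := Int.emod_lt_of_pos (2 * d + a) (b := 2 * a) (by positivity)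
  have : 2 * |d + -((2 * d + a) / (2 * a)) * a| = |2 * d + 2 * (-((2 * d + a) / (2 * a)) * a)| := by
    rw [← mul_add, abs_mul]; norm_num
  rw [this, abs_le]
  constructor <;> nlinarith

/-- A positive definite integral ternary form of determinant one represents only sums of three
squares. -/
lemma ternaryForm_sum_three_squares (n : ℕ) : ∀ a b c d e f : ℤ, 0 < a → 0 < a * b - d ^ 2 →
    a * b * c + 2 * d * e * f - a * f ^ 2 - b * e ^ 2 - c * d ^ 2 = 1 →
    a + (a * b - d ^ 2) ≤ n → ∀ x y z : ℤ,
    ∃ u v w : ℤ, ternaryForm a b c d e f x y z = u ^ 2 + v ^ 2 + w ^ 2 := by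
  induction n with
  | zero => intro a b c d e f ha hA _ hn; push_cast at hn; omega
  | succ n ih =>
    -- reduction in the last two variables, then in the first one
    have red : ∀ a b c d e f : ℤ, 0 < a → 0 < a * b - d ^ 2 →
        a * b * c + 2 * d * e * f - a * f ^ 2 - b * e ^ 2 - c * d ^ 2 = 1 →
        a + (a * b - d ^ 2) ≤ (n : ℤ) + 1 → 2 * |d| ≤ a → 2 * |e| ≤ a →
        2 * |a * f - d * e| ≤ a * b - d ^ 2 → ∀ x y z : ℤ,
        ∃ u v w : ℤ, ternaryForm a b c d e f x y z = u ^ 2 + v ^ 2 + w ^ 2 := by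
      intro a b c d e f ha hA hdet hn hd he hB x y z
      set A := a * b - d ^ 2 with hAdef
      set B := a * f - d * e with hBdef
      set C := a * c - e ^ 2 with hCdef
      have hABC : A * C - B ^ 2 = a := by
        rw [hAdef, hBdef, hCdef]; linear_combination a * hdet
      by_cases hba : b < a
      · have hb : 0 < b := by nlinarith [sq_nonneg d]
        obtain ⟨u, v, w, h⟩ := ih b a c d f e hb (by linarith) (by linarith) (by linarith) y x z
        exact ⟨u, v, w, by rw [← h]; unfold ternaryForm; ring⟩
      by_cases hCA : C < A
      · have hC : 0 < C := by nlinarith [sq_nonneg B]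
        obtain ⟨u, v, w, h⟩ := ih a c b e d f ha hC (by linarith) (by linarith) x z y
        exact ⟨u, v, w, by rw [← h]; unfold ternaryForm; ring⟩
      push Not at hba hCA
      have hB2 : 4 * B ^ 2 ≤ A ^ 2 := by
        have := sq_abs B; nlinarith [abs_nonneg B]
      have hd2 : 4 * d ^ 2 ≤ a ^ 2 := by
        have := sq_abs d; nlinarith [abs_nonneg d]
      have h1 : 3 * A ^ 2 ≤ 4 * a := by nlinarith
      have h2 : 3 * a ^ 2 ≤ 4 * A := by nlinarith
      have ha1 : a = 1 := by nlinarith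
      have hA1 : A = 1 := by nlinarith
      have hd0 : d = 0 := by nlinarith
      have he0 : e = 0 := by
        have := abs_nonneg e
        exact abs_eq_zero.mp (by omega)
      have hB0 : B = 0 := by nlinarith
      have hf0 : f = 0 := by rw [hBdef, ha1, hd0] at hB0; linarith
      have hb1 : b = 1 := by rw [hAdef, ha1, hd0] at hA1; linarith
      have hc1 : c = 1 := by rw [ha1, hb1, hd0, he0, hf0] at hdet; linarith
      exact ⟨x, y, z, by rw [ha1, hb1, hc1, hd0, he0, hf0]; unfold ternaryForm; ring⟩
    intro a b c d e f ha hA hdet hn x y z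
    obtain ⟨k, hk⟩ := exists_shift_abs_le (a * b - d ^ 2) (a * f - d * e) hA
    obtain ⟨l, hl⟩ := exists_shift_abs_le a d ha
    obtain ⟨j, hj⟩ := exists_shift_abs_le a (e + k * d) ha
    -- shift `y` by a multiple of `z`, then `x` by multiples of `y` and `z`
    obtain ⟨u, v, w, h⟩ := red a (b + 2 * l * d + l ^ 2 * a)
      ((c + 2 * k * f + k ^ 2 * b) + 2 * j * (e + k * d) + j ^ 2 * a) (d + l * a)
      (e + k * d + j * a) ((f + k * b) + l * (e + k * d) + j * d + l * j * a) ha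
      (by ring_nf at hA ⊢; linarith) (by rw [← hdet]; ring)
      (by push_cast at hn; ring_nf at hn ⊢; linarith) hl hj
      (by ring_nf at hk ⊢; exact hk) (x - l * (y - k * z) - j * z) (y - k * z) z
    exact ⟨u, v, w, by rw [← h]; unfold ternaryForm; ring⟩

lemma sum_three_squares_of_mod_four_eq_two (m : ℕ) (hm : m % 4 = 2) :
    ∃ x y z : ℤ, (m : ℤ) = x ^ 2 + y ^ 2 + z ^ 2 := by
  have hcop : Nat.Coprime (m - 1) (4 * m) := by
    apply Nat.Coprime.mul_right
    · have : (m - 1) % 4 = 1 := by omega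
      rw [show (4 : ℕ) = 2 ^ 2 by norm_num]
      apply Nat.Coprime.pow_right
      rw [Nat.coprime_two_right, Nat.odd_iff]; omega
    · rw [show m = (m - 1) + 1 by omega]
      simp
  have : NeZero (4 * m) := ⟨by omega⟩
  obtain ⟨p, hpm, hp, hpmod⟩ := Nat.forall_exists_prime_gt_and_modEq (4 * m) (by omega) hcop
  obtain ⟨j, hj⟩ : ∃ j : ℕ, p = (4 * j + 1) * m - 1 := by
    have h1 : (m - 1) ≤ p := by omega
    obtain ⟨j, hj⟩ := (Nat.modEq_iff_dvd' h1).mp hpmod.symm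
    refine ⟨j, ?_⟩
    have : (4 * j + 1) * m = 4 * m * j + m := by ring
    omega
  obtain ⟨q, hq⟩ : ∃ q, m = 4 * q + 2 := ⟨m / 4, by omega⟩
  set b := 4 * j + 1 with hb
  have hbm : b * m = p + 1 := by
    have : 0 < b * m := Nat.mul_pos (by omega) (by omega)
    omega
  have hp4 : p % 4 = 1 := by
    have : b * m = 4 * (4 * j * q + 2 * j + q) + 2 := by rw [hb, hq]; ring
    omega
  have := Fact.mk hp
  have hbodd : Odd b := ⟨2 * j, by omega⟩
  have hJ : jacobiSym (-(b : ℤ)) p = 1 := by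
    rw [jacobiSym.neg _ (Nat.odd_iff.mpr (by omega)), ZMod.χ₄_nat_one_mod_four hp4, one_mul,
      jacobiSym.quadratic_reciprocity_one_mod_four' hbodd hp4]
    have : (p : ℤ) ≡ -1 [ZMOD b] := by
      apply Int.ModEq.symm
      rw [Int.modEq_iff_dvd]
      exact ⟨m, by have := congrArg (Nat.cast (R := ℤ)) hbm; push_cast at this; linarith⟩
    rw [jacobiSym.mod_left, this, ← jacobiSym.mod_left, jacobiSym.at_neg_one hbodd,
      ZMod.χ₄_nat_one_mod_four (by omega)]
  rw [← jacobiSym.legendreSym.to_jacobiSym] at hJ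
  have hne : ((-(b : ℤ) : ℤ) : ZMod p) ≠ 0 := by
    intro h
    rw [(legendreSym.eq_zero_iff p _).mpr h] at hJ
    exact absurd hJ (by norm_num)
  obtain ⟨r, hr⟩ := (legendreSym.eq_one_iff p hne).mp hJ
  obtain ⟨r, rfl⟩ := ZMod.intCast_surjective r
  have hdvd : (p : ℤ) ∣ r ^ 2 + b := by
    rw [← ZMod.intCast_zmod_eq_zero_iff_dvd]
    push_cast at hr ⊢
    rw [pow_two, ← hr]; ring
  obtain ⟨a, ha⟩ := hdvd
  have hbm' : (b : ℤ) * m = p + 1 := by exact_mod_cast hbm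
  have hp0 : (0 : ℤ) < p := by exact_mod_cast hp.pos
  have hb0 : (0 : ℤ) < b := by exact_mod_cast (by omega : 0 < b)
  have ha0 : 0 < a := by
    by_contra h; push Not at h; nlinarith [sq_nonneg r]
  obtain ⟨u, v, w, h⟩ := ternaryForm_sum_three_squares (a + (a * p - r ^ 2)).toNat a p m r 1 0 ha0
    (by linarith) (by nlinarith) (by exact Int.self_le_toNat _) 0 0 1
  exact ⟨u, v, w, by rw [← h]; unfold ternaryForm; ring⟩

/-- Among the images of a lattice vector under signed permutations of the coordinates there is one
making a not too small angle with a given vector. -/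
lemma exists_sq_norm_eq_inner_sq_le (a b c x y z : ℤ) : ∃ x' y' z' : ℤ,
    x' ^ 2 + y' ^ 2 + z' ^ 2 = x ^ 2 + y ^ 2 + z ^ 2 ∧
    3 * (a * x' + b * y' + c * z') ^ 2 ≤ (a ^ 2 + b ^ 2 + c ^ 2) * (x ^ 2 + y ^ 2 + z ^ 2) := by
  by_contra! h
  have h1 := h x y z (by ring)
  have h2 := h x (-y) z (by ring)
  have h3 := h x y (-z) (by ring)
  have h4 := h (-x) y z (by ring)
  have h5 := h y z x (by ring)
  have h6 := h y (-z) x (by ring)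
  have h7 := h y z (-x) (by ring)
  have h8 := h (-y) z x (by ring)
  have h9 := h z x y (by ring)
  have h10 := h z (-x) y (by ring)
  have h11 := h z x (-y) (by ring)
  have h12 := h (-z) x y (by ring)
  linarith

/-- Frequencies `ξ k` whose squared lengths form an arithmetic progression with difference `4`,
consecutive ones making a not too small angle. -/
lemma exists_frequencies (m : ℕ) (hm : m % 4 = 2) : ∃ ξ : ℕ → ℤ × ℤ × ℤ,
    (∀ k, (ξ k).1 ^ 2 + (ξ k).2.1 ^ 2 + (ξ k).2.2 ^ 2 = m + 4 * k) ∧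
    ∀ k, 3 * ((ξ k).1 * (ξ (k + 1)).1 + (ξ k).2.1 * (ξ (k + 1)).2.1
      + (ξ k).2.2 * (ξ (k + 1)).2.2) ^ 2 ≤ (m + 4 * k) * (m + 4 * (k + 1)) := by
  have step : ∀ (k : ℕ) (u : ℤ × ℤ × ℤ), ∃ v : ℤ × ℤ × ℤ,
      v.1 ^ 2 + v.2.1 ^ 2 + v.2.2 ^ 2 = m + 4 * (k + 1) ∧
      3 * (u.1 * v.1 + u.2.1 * v.2.1 + u.2.2 * v.2.2) ^ 2 ≤
        (u.1 ^ 2 + u.2.1 ^ 2 + u.2.2 ^ 2) * (m + 4 * (k + 1)) := by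
    intro k u
    obtain ⟨x, y, z, h⟩ := sum_three_squares_of_mod_four_eq_two (m + 4 * (k + 1)) (by omega)
    obtain ⟨x', y', z', h1, h2⟩ := exists_sq_norm_eq_inner_sq_le u.1 u.2.1 u.2.2 x y z
    push_cast at h
    exact ⟨(x', y', z'), by rw [h1, h], by rw [h]; exact h2⟩
  obtain ⟨x, y, z, h0⟩ := sum_three_squares_of_mod_four_eq_two m hm
  choose g hg using step
  refine ⟨fun k => Nat.rec (x, y, z) (fun j u => g j u) k, ?_, ?_⟩
  · intro k
    cases k with
    | zero => simpa using h0.symm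
    | succ k => push_cast; exact (hg k _).1
  · intro k
    have h := (hg k (Nat.rec (x, y, z) (fun j u => g j u) k)).2
    refine h.trans (le_of_eq ?_)
    congr 1
    cases k with
    | zero => simpa using h0.symm
    | succ k => push_cast; exact (hg k _).1

/-- `u` is differentiable near `x`, with first derivative `a` and second derivative `b` at `x`. -/
def HasTwoJetAt (u : ℝ → ℝ) (x a b : ℝ) : Prop :=
  ∃ u' : ℝ → ℝ, (∀ᶠ τ in 𝓝 x, HasDerivAt u (u' τ) τ) ∧ u' x = a ∧ HasDerivAt u' b x

namespace HasTwoJetAt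

variable {u v : ℝ → ℝ} {x a b c d : ℝ}

lemma deriv_deriv_eq (h : HasTwoJetAt u x a b) : deriv (deriv u) x = b := by
  obtain ⟨u', h1, -, h3⟩ := h
  have : deriv u =ᶠ[𝓝 x] u' := h1.mono fun τ hτ => hτ.deriv
  rw [this.deriv_eq, h3.deriv]

lemma congr (h : HasTwoJetAt u x a b) (huv : v =ᶠ[𝓝 x] u) : HasTwoJetAt v x a b := by
  obtain ⟨u', h1, h2, h3⟩ := h
  refine ⟨u', ?_, h2, h3⟩
  filter_upwards [h1, huv.eventuallyEq_nhds] with τ hτ hτ'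
  exact hτ.congr_of_eventuallyEq hτ'

lemma congr_jet (h : HasTwoJetAt u x a b) (hc : c = a) (hd : d = b) : HasTwoJetAt u x c d := by
  rw [hc, hd]; exact h

lemma const (y : ℝ) : HasTwoJetAt (fun _ => y) x 0 0 :=
  ⟨fun _ => 0, Eventually.of_forall fun τ => hasDerivAt_const τ y, rfl, hasDerivAt_const x _⟩

lemma linear (y z : ℝ) : HasTwoJetAt (fun τ => y + z * τ) x z 0 :=
  ⟨fun _ => z, Eventually.of_forall fun τ => by
    simpa using ((hasDerivAt_id τ).const_mul z).const_add y, rfl, hasDerivAt_const x _⟩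

lemma add (hu : HasTwoJetAt u x a b) (hv : HasTwoJetAt v x c d) :
    HasTwoJetAt (fun τ => u τ + v τ) x (a + c) (b + d) := by
  obtain ⟨u', h1, h2, h3⟩ := hu
  obtain ⟨v', k1, k2, k3⟩ := hv
  refine ⟨fun τ => u' τ + v' τ, ?_, by beta_reduce; rw [h2, k2], h3.add k3⟩
  filter_upwards [h1, k1] with τ h k using h.add k

lemma mul (hu : HasTwoJetAt u x a b) (hv : HasTwoJetAt v x c d) :
    HasTwoJetAt (fun τ => u τ * v τ) x (a * v x + u x * c) (b * v x + 2 * (a * c) + u x * d) := by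
  obtain ⟨u', h1, h2, h3⟩ := hu
  obtain ⟨v', k1, k2, k3⟩ := hv
  refine ⟨fun τ => u' τ * v τ + u τ * v' τ, ?_, by beta_reduce; rw [h2, k2], ?_⟩
  · filter_upwards [h1, k1] with τ h k using h.mul k
  · have := (h3.mul k1.self_of_nhds).add (h1.self_of_nhds.mul k3)
    exact this.congr_deriv (by rw [h2, k2]; ring)

lemma const_mul (y : ℝ) (hu : HasTwoJetAt u x a b) :
    HasTwoJetAt (fun τ => y * u τ) x (y * a) (y * b) :=
  ((const y).mul hu).congr_jet (by ring) (by ring)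

lemma comp {θ : ℝ → ℝ} (hu : HasTwoJetAt u (θ x) a b) (hθ : HasTwoJetAt θ x c d) :
    HasTwoJetAt (fun τ => u (θ τ)) x (a * c) (b * c ^ 2 + a * d) := by
  obtain ⟨u', h1, h2, h3⟩ := hu
  obtain ⟨v', k1, k2, k3⟩ := hθ
  refine ⟨fun τ => u' (θ τ) * v' τ, ?_, by beta_reduce; rw [h2, k2], ?_⟩
  · have hc : ContinuousAt θ x := k1.self_of_nhds.continuousAt
    filter_upwards [hc.eventually h1, k1] with τ h k using h.comp τ k
  · have := (h3.comp x k1.self_of_nhds).mul k3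
    exact this.congr_deriv (by simp only [Function.comp, h2, k2]; ring)

lemma comp_linear {y : ℝ} (hu : HasTwoJetAt u y a b) (z : ℝ) :
    HasTwoJetAt (fun τ => u (y + z * τ)) 0 (a * z) (b * z ^ 2) := by
  have h : HasTwoJetAt u ((fun τ => y + z * τ) 0) a b := by simpa using hu
  exact (comp (θ := fun τ => y + z * τ) h (linear y z)).congr_jet rfl (by ring)

lemma of_hasDerivAt {u' : ℝ → ℝ} (h : ∀ τ, HasDerivAt u (u' τ) τ) (h' : HasDerivAt u' b x) :
    HasTwoJetAt u x (u' x) b := ⟨u', Eventually.of_forall h, rfl, h'⟩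

lemma of_contDiff (h : ContDiff ℝ (⊤ : ℕ∞) u) (x : ℝ) :
    HasTwoJetAt u x (deriv u x) (deriv (deriv u) x) := by
  refine of_hasDerivAt (fun τ => (h.differentiable (by simp) τ).hasDerivAt) ?_
  have := (contDiff_infty_iff_deriv.mp h).2
  exact (this.differentiable (by simp) x).hasDerivAt

lemma cos (hu : HasTwoJetAt u x a b) : HasTwoJetAt (fun τ => Real.cos (u τ)) x
    (-Real.sin (u x) * a) (-Real.cos (u x) * a ^ 2 - Real.sin (u x) * b) :=
  ((of_hasDerivAt (fun τ => Real.hasDerivAt_cos τ)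
    (Real.hasDerivAt_sin (u x)).neg).comp hu).congr_jet rfl (by ring)

lemma exp (hu : HasTwoJetAt u x a b) : HasTwoJetAt (fun τ => Real.exp (u τ)) x
    (Real.exp (u x) * a) (Real.exp (u x) * a ^ 2 + Real.exp (u x) * b) :=
  (of_hasDerivAt (fun τ => Real.hasDerivAt_exp τ) (Real.hasDerivAt_exp (u x))).comp hu

lemma of_contDiffAt {E : Type*} [NormedAddCommGroup E] [NormedSpace ℝ E] {f : E → ℝ} {p : E}
    (h : ContDiffAt ℝ 2 f p) (v : E) :
    HasTwoJetAt (fun τ => f (p + τ • v)) 0 (fderiv ℝ f p v) (fderiv ℝ (fderiv ℝ f) p v v) := by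
  have hline : ∀ τ : ℝ, HasDerivAt (fun τ : ℝ => p + τ • v) v τ := fun τ => by
    simpa using ((hasDerivAt_id τ).smul_const v).const_add p
  have hcont : Tendsto (fun τ : ℝ => p + τ • v) (𝓝 0) (𝓝 p) := by
    have := (hline 0).continuousAt.tendsto
    simpa using this
  refine ⟨fun τ => fderiv ℝ f (p + τ • v) v, ?_, by simp, ?_⟩
  · have h1 : ∀ᶠ q in 𝓝 p, DifferentiableAt ℝ f q := by
      filter_upwards [h.eventually (by simp)] with q hq using hq.differentiableAt (by simp)
    filter_upwards [hcont.eventually h1] with τ hτ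
    exact hτ.hasFDerivAt.comp_hasDerivAt τ (hline τ)
  · have h2 : DifferentiableAt ℝ (fderiv ℝ f) p :=
      (h.fderiv_right (m := 1) (by norm_num)).differentiableAt (by simp)
    have h3 : HasFDerivAt (fderiv ℝ f) (fderiv ℝ (fderiv ℝ f) p) (p + (0 : ℝ) • v) := by
      simpa using h2.hasFDerivAt
    have h4 : HasDerivAt (fun τ : ℝ => fderiv ℝ f (p + τ • v)) (fderiv ℝ (fderiv ℝ f) p v) 0 :=
      h3.comp_hasDerivAt (0 : ℝ) (hline 0)
    simpa using h4.clm_apply (hasDerivAt_const (0 : ℝ) v)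

end HasTwoJetAt

/-- Exponent profile of the amplitudes in the local model. -/
noncomputable def cutE (t : ℝ) : ℝ := (2 - t) / 2 * Real.smoothTransition (4 * t - 1)

/-- Cutoff profile of the amplitudes in the local model. -/
noncomputable def cutW (t : ℝ) : ℝ := Real.smoothTransition (7 - 2 * t)

/-- A smooth periodic phase correction, of slope `-σ` near the odd multiples of `π`. -/
noncomputable def phase (σ s : ℝ) : ℝ :=
  σ * (Real.smoothTransition (-5 * Real.cos s - 3) * Real.arcsin (Real.sin s))

/-- The amplitude `exp (γ e) w`. -/
noncomputable def amp (γ t : ℝ) : ℝ := Real.exp (γ * cutE t) * cutW t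

/-- The first derivative of `amp γ`. -/
noncomputable def amp' (γ t : ℝ) : ℝ :=
  Real.exp (γ * cutE t) * (γ * deriv cutE t * cutW t + deriv cutW t)

/-- The second derivative of `amp γ`. -/
noncomputable def amp'' (γ t : ℝ) : ℝ :=
  Real.exp (γ * cutE t) * ((γ * deriv cutE t) ^ 2 * cutW t + γ * deriv (deriv cutE) t * cutW t +
    2 * (γ * deriv cutE t * deriv cutW t) + deriv (deriv cutW) t)

@[fun_prop]
lemma contDiff_cutE : ContDiff ℝ (⊤ : ℕ∞) cutE := by
  have := @Real.smoothTransition.contDiff (⊤ : ℕ∞)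
  unfold cutE
  fun_prop

@[fun_prop]
lemma contDiff_cutW : ContDiff ℝ (⊤ : ℕ∞) cutW := by
  have := @Real.smoothTransition.contDiff (⊤ : ℕ∞)
  unfold cutW
  fun_prop

lemma ContDiff.deriv_infty {u : ℝ → ℝ} (h : ContDiff ℝ (⊤ : ℕ∞) u) :
    ContDiff ℝ (⊤ : ℕ∞) (deriv u) := (contDiff_infty_iff_deriv.mp h).2

@[fun_prop]
lemma contDiff_deriv_cutE : ContDiff ℝ (⊤ : ℕ∞) (deriv cutE) := contDiff_cutE.deriv_infty

@[fun_prop]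
lemma contDiff_deriv_cutW : ContDiff ℝ (⊤ : ℕ∞) (deriv cutW) := contDiff_cutW.deriv_infty

@[fun_prop]
lemma contDiff_deriv_deriv_cutE : ContDiff ℝ (⊤ : ℕ∞) (deriv (deriv cutE)) :=
  contDiff_deriv_cutE.deriv_infty

@[fun_prop]
lemma contDiff_deriv_deriv_cutW : ContDiff ℝ (⊤ : ℕ∞) (deriv (deriv cutW)) :=
  contDiff_deriv_cutW.deriv_infty

lemma phase_eq_zero {σ s : ℝ} (hs : -(3 / 5) ≤ Real.cos s) : phase σ s = 0 := by
  rw [phase, Real.smoothTransition.zero_of_nonpos (by linarith)]; simp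

@[fun_prop]
lemma contDiff_phase (σ : ℝ) : ContDiff ℝ (⊤ : ℕ∞) (phase σ) := by
  rw [contDiff_iff_contDiffAt]
  intro s
  rcases lt_or_ge (-(3 / 5)) (Real.cos s) with hs | hs
  · have : phase σ =ᶠ[𝓝 s] fun _ => 0 := by
      filter_upwards [Real.continuous_cos.continuousAt.eventually (lt_mem_nhds hs)] with r hr
      exact phase_eq_zero (le_of_lt hr)
    exact contDiffAt_const.congr_of_eventuallyEq this
  · have h1 : ContDiffAt ℝ (⊤ : ℕ∞) Real.arcsin (Real.sin s) := by
      apply Real.contDiffAt_arcsin <;> intro h <;>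
        nlinarith [Real.sin_sq_add_cos_sq s]
    have h2 : ContDiffAt ℝ (⊤ : ℕ∞) (fun s => Real.arcsin (Real.sin s)) s :=
      h1.comp s Real.contDiff_sin.contDiffAt
    have h3 : ContDiff ℝ (⊤ : ℕ∞) (fun s => Real.smoothTransition (-5 * Real.cos s - 3)) :=
      Real.smoothTransition.contDiff.comp (by fun_prop)
    exact contDiffAt_const.mul (h3.contDiffAt.mul h2)

@[fun_prop]
lemma contDiff_deriv_phase (σ : ℝ) : ContDiff ℝ (⊤ : ℕ∞) (deriv (phase σ)) :=
  (contDiff_phase σ).deriv_infty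

@[fun_prop]
lemma contDiff_deriv_deriv_phase (σ : ℝ) : ContDiff ℝ (⊤ : ℕ∞) (deriv (deriv (phase σ))) :=
  (contDiff_deriv_phase σ).deriv_infty

lemma deriv_phase {σ s : ℝ} (hs : Real.cos s < -(4 / 5)) : deriv (phase σ) s = -σ := by
  have h1 : phase σ =ᶠ[𝓝 s] fun r => σ * Real.arcsin (Real.sin r) := by
    filter_upwards [Real.continuous_cos.continuousAt.eventually (gt_mem_nhds hs)] with r hr
    rw [phase, Real.smoothTransition.one_of_one_le (by linarith), one_mul]
  rw [h1.deriv_eq]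
  have h2 : HasDerivAt Real.arcsin (1 / √(1 - Real.sin s ^ 2)) (Real.sin s) := by
    apply Real.hasDerivAt_arcsin <;> intro h <;> nlinarith [Real.sin_sq_add_cos_sq s]
  have h3 := ((h2.comp s (Real.hasDerivAt_sin s)).const_mul σ).deriv
  simp only [Function.comp_def] at h3
  rw [h3, show 1 - Real.sin s ^ 2 = Real.cos s ^ 2 by linarith [Real.sin_sq_add_cos_sq s],
    Real.sqrt_sq_eq_abs, abs_of_neg (by linarith)]
  have : Real.cos s ≠ 0 := by linarith
  field_simp

lemma deriv_deriv_phase {σ s : ℝ} (hs : Real.cos s < -(4 / 5)) :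
    deriv (deriv (phase σ)) s = 0 := by
  have h1 : deriv (phase σ) =ᶠ[𝓝 s] fun r => -σ := by
    filter_upwards [Real.continuous_cos.continuousAt.eventually (gt_mem_nhds hs)] with r hr
    exact deriv_phase hr
  rw [h1.deriv_eq]; simp

lemma phase_periodic (σ : ℝ) : Function.Periodic (phase σ) (2 * π) := by
  intro s; simp [phase]

lemma Function.Periodic.deriv_real {u : ℝ → ℝ} {c : ℝ} (h : Function.Periodic u c) :
    Function.Periodic (deriv u) c := by
  intro s
  rw [← deriv_comp_add_const]
  congr 1
  exact funext h

lemma cutE_of_le {t : ℝ} (h : t ≤ 1 / 4) : cutE t = 0 := by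
  rw [cutE, Real.smoothTransition.zero_of_nonpos (by linarith), mul_zero]

lemma cutE_of_ge {t : ℝ} (h : 1 / 2 ≤ t) : cutE t = (2 - t) / 2 := by
  rw [cutE, Real.smoothTransition.one_of_one_le (by linarith), mul_one]

lemma cutW_of_le {t : ℝ} (h : t ≤ 3) : cutW t = 1 := by
  rw [cutW, Real.smoothTransition.one_of_one_le (by linarith)]

lemma cutW_of_ge {t : ℝ} (h : 7 / 2 ≤ t) : cutW t = 0 := by
  rw [cutW, Real.smoothTransition.zero_of_nonpos (by linarith)]

lemma deriv_cutE_of_lt {t : ℝ} (h : t < 1 / 4) : deriv cutE t = 0 := by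
  have : cutE =ᶠ[𝓝 t] fun _ => 0 := by
    filter_upwards [gt_mem_nhds h] with r hr using cutE_of_le (le_of_lt hr)
  rw [this.deriv_eq]; simp

lemma deriv_cutE_of_gt {t : ℝ} (h : 1 / 2 < t) : deriv cutE t = -1 / 2 := by
  have : cutE =ᶠ[𝓝 t] fun t => (2 - t) / 2 := by
    filter_upwards [lt_mem_nhds h] with r hr using cutE_of_ge (le_of_lt hr)
  rw [this.deriv_eq]; simp

lemma deriv_cutW_of_lt {t : ℝ} (h : t < 3) : deriv cutW t = 0 := by
  have : cutW =ᶠ[𝓝 t] fun _ => 1 := by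
    filter_upwards [gt_mem_nhds h] with r hr using cutW_of_le (le_of_lt hr)
  rw [this.deriv_eq]; simp

lemma deriv_cutW_of_gt {t : ℝ} (h : 7 / 2 < t) : deriv cutW t = 0 := by
  have : cutW =ᶠ[𝓝 t] fun _ => 0 := by
    filter_upwards [lt_mem_nhds h] with r hr using cutW_of_ge (le_of_lt hr)
  rw [this.deriv_eq]; simp

lemma deriv_deriv_cutE_of_lt {t : ℝ} (h : t < 1 / 4) : deriv (deriv cutE) t = 0 := by
  have : deriv cutE =ᶠ[𝓝 t] fun _ => 0 := by
    filter_upwards [gt_mem_nhds h] with r hr using deriv_cutE_of_lt hr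
  rw [this.deriv_eq]; simp

lemma deriv_deriv_cutE_of_gt {t : ℝ} (h : 1 / 2 < t) : deriv (deriv cutE) t = 0 := by
  have : deriv cutE =ᶠ[𝓝 t] fun _ => -1 / 2 := by
    filter_upwards [lt_mem_nhds h] with r hr using deriv_cutE_of_gt hr
  rw [this.deriv_eq]; simp

lemma deriv_deriv_cutW_of_lt {t : ℝ} (h : t < 3) : deriv (deriv cutW) t = 0 := by
  have : deriv cutW =ᶠ[𝓝 t] fun _ => 0 := by
    filter_upwards [gt_mem_nhds h] with r hr using deriv_cutW_of_lt hr
  rw [this.deriv_eq]; simp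

lemma deriv_deriv_cutW_of_gt {t : ℝ} (h : 7 / 2 < t) : deriv (deriv cutW) t = 0 := by
  have : deriv cutW =ᶠ[𝓝 t] fun _ => 0 := by
    filter_upwards [lt_mem_nhds h] with r hr using deriv_cutW_of_gt hr
  rw [this.deriv_eq]; simp

lemma amp_of_lt {γ t : ℝ} (h : t < 1 / 4) : amp γ t = 1 ∧ amp' γ t = 0 ∧ amp'' γ t = 0 := by
  simp [amp, amp', amp'', cutE_of_le h.le, cutW_of_le (show t ≤ 3 by linarith),
    deriv_cutE_of_lt h, deriv_deriv_cutE_of_lt h, deriv_cutW_of_lt (show t < 3 by linarith),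
    deriv_deriv_cutW_of_lt (show t < 3 by linarith)]

lemma amp_of_gt {γ t : ℝ} (h : 7 / 2 < t) : amp γ t = 0 ∧ amp' γ t = 0 ∧ amp'' γ t = 0 := by
  simp [amp, amp', amp'', cutW_of_ge h.le, deriv_cutW_of_gt h, deriv_deriv_cutW_of_gt h]

lemma amp_of_mid {γ t : ℝ} (h : 1 < t) (h' : t < 3) :
    amp' γ t = -(γ / 2) * amp γ t ∧ amp'' γ t = γ ^ 2 / 4 * amp γ t ∧ 0 < amp γ t := by
  have h2 : 1 / 2 < t := by linarith
  simp only [amp, amp', amp'', cutE_of_ge h2.le, cutW_of_le h'.le, deriv_cutE_of_gt h2,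
    deriv_deriv_cutE_of_gt h2, deriv_cutW_of_lt h', deriv_deriv_cutW_of_lt h']
  exact ⟨by ring, by ring, by positivity⟩

lemma amp_nonneg (γ t : ℝ) : 0 ≤ amp γ t :=
  mul_nonneg (Real.exp_pos _).le (Real.smoothTransition.nonneg _)

lemma one_le_amp {γ t : ℝ} (hγ : 0 < γ) (h : t ≤ 1) : 1 ≤ amp γ t := by
  rw [amp, cutW_of_le (by linarith), mul_one]
  exact Real.one_le_exp (mul_nonneg hγ.le
    (mul_nonneg (by linarith) (Real.smoothTransition.nonneg _)))

lemma amp_lt_one {γ t : ℝ} (hγ : 0 < γ) (h : 3 ≤ t) : amp γ t < 1 := by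
  rw [amp, cutE_of_ge (by linarith)]
  have h1 : Real.exp (γ * ((2 - t) / 2)) < 1 := Real.exp_lt_one_iff.mpr (by nlinarith)
  have h2 : cutW t ≤ 1 := Real.smoothTransition.le_one _
  have h3 : 0 ≤ cutW t := Real.smoothTransition.nonneg _
  nlinarith [Real.exp_pos (γ * ((2 - t) / 2))]

lemma hasTwoJetAt_amp (γ t : ℝ) : HasTwoJetAt (amp γ) t (amp' γ t) (amp'' γ t) :=
  (((HasTwoJetAt.of_contDiff contDiff_cutE t).const_mul γ).exp.mul
    (HasTwoJetAt.of_contDiff contDiff_cutW t)).congr_jet (by rw [amp']; ring)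
      (by rw [amp'']; ring)

lemma hasTwoJetAt_amp_reflect (γ t : ℝ) :
    HasTwoJetAt (fun τ => amp γ (4 - t - τ)) 0 (-amp' γ (4 - t)) (amp'' γ (4 - t)) := by
  refine (((hasTwoJetAt_amp γ (4 - t)).comp_linear (-1)).congr ?_).congr_jet (by simp) (by simp)
  exact Eventually.of_forall fun τ => by simp [sub_eq_add_neg]

/-- The oscillation rate of the phase correction. -/
noncomputable def phaseRate (κ : ℝ) : ℝ := 4 + 8 * κ

/-- The exponential rate of the amplitudes. -/
noncomputable def rate (κ μ : ℝ) : ℝ := 4 * (1 - phaseRate κ * μ)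

/-- The phase of the second wave. -/
noncomputable def phaseTwo (κ t α s μ : ℝ) : ℝ := α + s + μ * cutW t * phase (phaseRate κ) s

/-- The superposition of two waves. -/
noncomputable def waveSum (κ t α s μ : ℝ) : ℝ :=
  amp (rate κ μ) t * Real.cos α + amp (rate κ μ) (4 - t) * Real.cos (phaseTwo κ t α s μ)

/-- The `t`-derivative of `waveSum`. -/
noncomputable def waveSumT (κ t α s μ : ℝ) : ℝ :=
  amp' (rate κ μ) t * Real.cos α - amp' (rate κ μ) (4 - t) * Real.cos (phaseTwo κ t α s μ)
    - amp (rate κ μ) (4 - t) * Real.sin (phaseTwo κ t α s μ) *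
      (μ * deriv cutW t * phase (phaseRate κ) s)

/-- The second `t`-derivative of `waveSum`. -/
noncomputable def waveSumTT (κ t α s μ : ℝ) : ℝ :=
  amp'' (rate κ μ) t * Real.cos α + amp'' (rate κ μ) (4 - t) * Real.cos (phaseTwo κ t α s μ)
    + 2 * amp' (rate κ μ) (4 - t) * Real.sin (phaseTwo κ t α s μ) *
      (μ * deriv cutW t * phase (phaseRate κ) s)
    - amp (rate κ μ) (4 - t) * (Real.cos (phaseTwo κ t α s μ) *
      (μ * deriv cutW t * phase (phaseRate κ) s) ^ 2 + Real.sin (phaseTwo κ t α s μ) *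
      (μ * deriv (deriv cutW) t * phase (phaseRate κ) s))

/-- The `s`-derivative of the phase of the second wave. -/
noncomputable def phaseSlope (κ t s μ : ℝ) : ℝ := 1 + μ * cutW t * deriv (phase (phaseRate κ)) s

/-- The `α`-derivative of `waveSum`. -/
noncomputable def waveSumA (κ t α s μ : ℝ) : ℝ :=
  -(amp (rate κ μ) t * Real.sin α + amp (rate κ μ) (4 - t) * Real.sin (phaseTwo κ t α s μ))

/-- The `s`-derivative of `waveSum`. -/
noncomputable def waveSumS (κ t α s μ : ℝ) : ℝ :=
  -(amp (rate κ μ) (4 - t) * Real.sin (phaseTwo κ t α s μ) * phaseSlope κ t s μ)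

lemma hasTwoJetAt_waveSum_t (κ t α s μ : ℝ) :
    HasTwoJetAt (fun τ => waveSum κ (t + τ) α s μ) 0 (waveSumT κ t α s μ)
      (waveSumTT κ t α s μ) := by
  have h1 := ((hasTwoJetAt_amp (rate κ μ) t).comp_linear 1).mul
    (HasTwoJetAt.const (Real.cos α))
  have hw := (HasTwoJetAt.of_contDiff contDiff_cutW t).comp_linear 1
  have hβ := (((hw.const_mul μ).mul (HasTwoJetAt.const (phase (phaseRate κ) s))).add
    (HasTwoJetAt.const (α + s))).cos
  have h2 := (hasTwoJetAt_amp_reflect (rate κ μ) t).mul hβ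
  have hp : α + s + μ * cutW t * phase (phaseRate κ) s =
    μ * cutW t * phase (phaseRate κ) s + (α + s) := by ring
  refine ((h1.add h2).congr ?_).congr_jet ?_ ?_
  · refine Eventually.of_forall fun τ => ?_
    simp only [waveSum, phaseTwo, one_mul, sub_sub]
    rw [add_comm (α + s)]
  · simp only [waveSumT, phaseTwo, hp, mul_zero, add_zero, sub_zero]
    ring
  · simp only [waveSumTT, phaseTwo, hp, mul_zero, add_zero, sub_zero]
    ring

lemma hasTwoJetAt_waveSum_line (κ t α s μ ξ η : ℝ) :
    HasTwoJetAt (fun τ => waveSum κ t (α + ξ * τ) (s + η * τ) μ) 0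
      (waveSumA κ t α s μ * ξ + waveSumS κ t α s μ * η)
      (-waveSum κ t α s μ * ξ ^ 2
        - 2 * amp (rate κ μ) (4 - t) * Real.cos (phaseTwo κ t α s μ) * phaseSlope κ t s μ *
          (ξ * η)
        - amp (rate κ μ) (4 - t) * (Real.cos (phaseTwo κ t α s μ) * phaseSlope κ t s μ ^ 2
          + Real.sin (phaseTwo κ t α s μ) * (μ * cutW t * deriv (deriv (phase (phaseRate κ))) s)) *
          η ^ 2) := by
  have hα := HasTwoJetAt.linear (x := 0) α ξ
  have hs := HasTwoJetAt.linear (x := 0) s η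
  have hφ := ((HasTwoJetAt.of_contDiff (contDiff_phase (phaseRate κ)) s).comp_linear η)
  have hβ := (hα.add hs).add (hφ.const_mul (μ * cutW t))
  have h := (hα.cos.const_mul (amp (rate κ μ) t)).add (hβ.cos.const_mul (amp (rate κ μ) (4 - t)))
  refine h.congr_jet ?_ ?_
  · simp only [waveSumA, waveSumS, phaseTwo, phaseSlope, mul_zero, add_zero]
    ring
  · simp only [waveSum, phaseTwo, phaseSlope, mul_zero, add_zero]
    ring

/-- The reciprocal of `T` in the local coordinates. -/
noncomputable def invT (t μ ρ : ℝ) : ℝ := μ * ρ / (1 + μ * ρ * t)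

/-- The potential solved by the superposition of two waves. -/
noncomputable def wavePot (κ t μ ρ : ℝ) : ℝ :=
  t - 4 * (1 - cutW t) + cutW t * cutW (4 - t) *
    (κ * rate κ μ + κ ^ 2 * rate κ μ ^ 2 / 4 * invT t μ ρ)

/-- The residual of the superposition of two waves. -/
noncomputable def waveRes (κ t α s μ ρ : ℝ) : ℝ :=
  (t - wavePot κ t μ ρ) * waveSum κ t α s μ - 2 * κ * waveSumT κ t α s μ
    + κ ^ 2 * invT t μ ρ * waveSumTT κ t α s μ
    - amp (rate κ μ) (4 - t) * (Real.cos (phaseTwo κ t α s μ) *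
      (4 + cutW t * deriv (phase (phaseRate κ)) s * (1 + 4 * μ)
        + μ * (cutW t * deriv (phase (phaseRate κ)) s) ^ 2)
      + Real.sin (phaseTwo κ t α s μ) * (cutW t * deriv (deriv (phase (phaseRate κ))) s))

/-- The normalized square of the one-jet of the superposition of two waves. -/
noncomputable def waveGram (κ t α s μ ρ : ℝ) : ℝ :=
  waveSumA κ t α s μ ^ 2 - (ρ - 4 * μ * ρ) * (waveSumA κ t α s μ * waveSumS κ t α s μ)
    + ρ * waveSumS κ t α s μ ^ 2 + κ ^ 2 * invT t μ ρ * (μ * ρ) * waveSumT κ t α s μ ^ 2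
    + waveSum κ t α s μ ^ 2

/-- The corrector. -/
noncomputable def waveCorr (κ t α s μ ρ : ℝ) : ℝ :=
  waveRes κ t α s μ ρ / (2 * waveGram κ t α s μ ρ)

/-- The corrected superposition of two waves. -/
noncomputable def wave (κ t α s μ ρ : ℝ) : ℝ :=
  waveSum κ t α s μ - μ * ρ * waveSum κ t α s μ ^ 2 * waveCorr κ t α s μ ρ

section Smooth

variable {E : Type*} [NormedAddCommGroup E] [NormedSpace ℝ E] {f g : E → ℝ} {x : E}

@[fun_prop]
lemma ContDiffAt.cutE (hf : ContDiffAt ℝ (⊤ : ℕ∞) f x) :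
    ContDiffAt ℝ (⊤ : ℕ∞) (fun x => cutE (f x)) x := contDiff_cutE.contDiffAt.comp x hf

@[fun_prop]
lemma ContDiffAt.cutW (hf : ContDiffAt ℝ (⊤ : ℕ∞) f x) :
    ContDiffAt ℝ (⊤ : ℕ∞) (fun x => cutW (f x)) x := contDiff_cutW.contDiffAt.comp x hf

@[fun_prop]
lemma ContDiffAt.deriv_cutE (hf : ContDiffAt ℝ (⊤ : ℕ∞) f x) :
    ContDiffAt ℝ (⊤ : ℕ∞) (fun x => deriv _root_.cutE (f x)) x :=
  contDiff_deriv_cutE.contDiffAt.comp x hf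

@[fun_prop]
lemma ContDiffAt.deriv_cutW (hf : ContDiffAt ℝ (⊤ : ℕ∞) f x) :
    ContDiffAt ℝ (⊤ : ℕ∞) (fun x => deriv _root_.cutW (f x)) x :=
  contDiff_deriv_cutW.contDiffAt.comp x hf

@[fun_prop]
lemma ContDiffAt.deriv_deriv_cutE (hf : ContDiffAt ℝ (⊤ : ℕ∞) f x) :
    ContDiffAt ℝ (⊤ : ℕ∞) (fun x => deriv (deriv _root_.cutE) (f x)) x :=
  contDiff_deriv_deriv_cutE.contDiffAt.comp x hf

@[fun_prop]
lemma ContDiffAt.deriv_deriv_cutW (hf : ContDiffAt ℝ (⊤ : ℕ∞) f x) :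
    ContDiffAt ℝ (⊤ : ℕ∞) (fun x => deriv (deriv _root_.cutW) (f x)) x :=
  contDiff_deriv_deriv_cutW.contDiffAt.comp x hf

@[fun_prop]
lemma ContDiffAt.phase (σ : ℝ) (hf : ContDiffAt ℝ (⊤ : ℕ∞) f x) :
    ContDiffAt ℝ (⊤ : ℕ∞) (fun x => phase σ (f x)) x := (contDiff_phase σ).contDiffAt.comp x hf

@[fun_prop]
lemma ContDiffAt.deriv_phase (σ : ℝ) (hf : ContDiffAt ℝ (⊤ : ℕ∞) f x) :
    ContDiffAt ℝ (⊤ : ℕ∞) (fun x => deriv (_root_.phase σ) (f x)) x :=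
  (contDiff_deriv_phase σ).contDiffAt.comp x hf

@[fun_prop]
lemma ContDiffAt.deriv_deriv_phase (σ : ℝ) (hf : ContDiffAt ℝ (⊤ : ℕ∞) f x) :
    ContDiffAt ℝ (⊤ : ℕ∞) (fun x => deriv (deriv (_root_.phase σ)) (f x)) x :=
  (contDiff_deriv_deriv_phase σ).contDiffAt.comp x hf

@[fun_prop]
lemma ContDiffAt.amp (hf : ContDiffAt ℝ (⊤ : ℕ∞) f x) (hg : ContDiffAt ℝ (⊤ : ℕ∞) g x) :
    ContDiffAt ℝ (⊤ : ℕ∞) (fun x => amp (f x) (g x)) x := by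
  unfold _root_.amp; fun_prop

@[fun_prop]
lemma ContDiffAt.amp' (hf : ContDiffAt ℝ (⊤ : ℕ∞) f x) (hg : ContDiffAt ℝ (⊤ : ℕ∞) g x) :
    ContDiffAt ℝ (⊤ : ℕ∞) (fun x => amp' (f x) (g x)) x := by
  unfold _root_.amp'; fun_prop

@[fun_prop]
lemma ContDiffAt.amp'' (hf : ContDiffAt ℝ (⊤ : ℕ∞) f x) (hg : ContDiffAt ℝ (⊤ : ℕ∞) g x) :
    ContDiffAt ℝ (⊤ : ℕ∞) (fun x => amp'' (f x) (g x)) x := by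
  unfold _root_.amp''; fun_prop

variable {t α s μ ρ : E → ℝ}

@[fun_prop]
lemma ContDiffAt.phaseTwo (κ : ℝ) (ht : ContDiffAt ℝ (⊤ : ℕ∞) t x)
    (hα : ContDiffAt ℝ (⊤ : ℕ∞) α x) (hs : ContDiffAt ℝ (⊤ : ℕ∞) s x)
    (hμ : ContDiffAt ℝ (⊤ : ℕ∞) μ x) :
    ContDiffAt ℝ (⊤ : ℕ∞) (fun x => phaseTwo κ (t x) (α x) (s x) (μ x)) x := by
  unfold _root_.phaseTwo; fun_prop

@[fun_prop]
lemma ContDiffAt.rate (κ : ℝ) (hμ : ContDiffAt ℝ (⊤ : ℕ∞) μ x) :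
    ContDiffAt ℝ (⊤ : ℕ∞) (fun x => rate κ (μ x)) x := by
  unfold _root_.rate; fun_prop

@[fun_prop]
lemma ContDiffAt.waveSum (κ : ℝ) (ht : ContDiffAt ℝ (⊤ : ℕ∞) t x)
    (hα : ContDiffAt ℝ (⊤ : ℕ∞) α x) (hs : ContDiffAt ℝ (⊤ : ℕ∞) s x)
    (hμ : ContDiffAt ℝ (⊤ : ℕ∞) μ x) :
    ContDiffAt ℝ (⊤ : ℕ∞) (fun x => waveSum κ (t x) (α x) (s x) (μ x)) x := by
  unfold _root_.waveSum; fun_prop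

@[fun_prop]
lemma ContDiffAt.waveSumT (κ : ℝ) (ht : ContDiffAt ℝ (⊤ : ℕ∞) t x)
    (hα : ContDiffAt ℝ (⊤ : ℕ∞) α x) (hs : ContDiffAt ℝ (⊤ : ℕ∞) s x)
    (hμ : ContDiffAt ℝ (⊤ : ℕ∞) μ x) :
    ContDiffAt ℝ (⊤ : ℕ∞) (fun x => waveSumT κ (t x) (α x) (s x) (μ x)) x := by
  unfold _root_.waveSumT; fun_prop

@[fun_prop]
lemma ContDiffAt.waveSumTT (κ : ℝ) (ht : ContDiffAt ℝ (⊤ : ℕ∞) t x)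
    (hα : ContDiffAt ℝ (⊤ : ℕ∞) α x) (hs : ContDiffAt ℝ (⊤ : ℕ∞) s x)
    (hμ : ContDiffAt ℝ (⊤ : ℕ∞) μ x) :
    ContDiffAt ℝ (⊤ : ℕ∞) (fun x => waveSumTT κ (t x) (α x) (s x) (μ x)) x := by
  unfold _root_.waveSumTT; fun_prop

@[fun_prop]
lemma ContDiffAt.waveSumA (κ : ℝ) (ht : ContDiffAt ℝ (⊤ : ℕ∞) t x)
    (hα : ContDiffAt ℝ (⊤ : ℕ∞) α x) (hs : ContDiffAt ℝ (⊤ : ℕ∞) s x)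
    (hμ : ContDiffAt ℝ (⊤ : ℕ∞) μ x) :
    ContDiffAt ℝ (⊤ : ℕ∞) (fun x => waveSumA κ (t x) (α x) (s x) (μ x)) x := by
  unfold _root_.waveSumA; fun_prop

@[fun_prop]
lemma ContDiffAt.waveSumS (κ : ℝ) (ht : ContDiffAt ℝ (⊤ : ℕ∞) t x)
    (hα : ContDiffAt ℝ (⊤ : ℕ∞) α x) (hs : ContDiffAt ℝ (⊤ : ℕ∞) s x)
    (hμ : ContDiffAt ℝ (⊤ : ℕ∞) μ x) :
    ContDiffAt ℝ (⊤ : ℕ∞) (fun x => waveSumS κ (t x) (α x) (s x) (μ x)) x := by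
  unfold _root_.waveSumS phaseSlope; fun_prop

lemma ContDiffAt.invT (ht : ContDiffAt ℝ (⊤ : ℕ∞) t x) (hμ : ContDiffAt ℝ (⊤ : ℕ∞) μ x)
    (hρ : ContDiffAt ℝ (⊤ : ℕ∞) ρ x) (h0 : 1 + μ x * ρ x * t x ≠ 0) :
    ContDiffAt ℝ (⊤ : ℕ∞) (fun x => invT (t x) (μ x) (ρ x)) x := by
  unfold _root_.invT; fun_prop (disch := assumption)

lemma ContDiffAt.waveRes (κ : ℝ) (ht : ContDiffAt ℝ (⊤ : ℕ∞) t x)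
    (hα : ContDiffAt ℝ (⊤ : ℕ∞) α x) (hs : ContDiffAt ℝ (⊤ : ℕ∞) s x)
    (hμ : ContDiffAt ℝ (⊤ : ℕ∞) μ x) (hρ : ContDiffAt ℝ (⊤ : ℕ∞) ρ x)
    (h0 : 1 + μ x * ρ x * t x ≠ 0) :
    ContDiffAt ℝ (⊤ : ℕ∞) (fun x => waveRes κ (t x) (α x) (s x) (μ x) (ρ x)) x := by
  have := ht.invT hμ hρ h0
  unfold _root_.waveRes wavePot; fun_prop

lemma ContDiffAt.waveGram (κ : ℝ) (ht : ContDiffAt ℝ (⊤ : ℕ∞) t x)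
    (hα : ContDiffAt ℝ (⊤ : ℕ∞) α x) (hs : ContDiffAt ℝ (⊤ : ℕ∞) s x)
    (hμ : ContDiffAt ℝ (⊤ : ℕ∞) μ x) (hρ : ContDiffAt ℝ (⊤ : ℕ∞) ρ x)
    (h0 : 1 + μ x * ρ x * t x ≠ 0) :
    ContDiffAt ℝ (⊤ : ℕ∞) (fun x => waveGram κ (t x) (α x) (s x) (μ x) (ρ x)) x := by
  have := ht.invT hμ hρ h0
  unfold _root_.waveGram; fun_prop

end Smooth

lemma waveRes_of_mid {κ t α s μ ρ : ℝ} (h1 : 1 < t) (h3 : t < 3) (hs : Real.cos s < -(4 / 5)) :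
    waveRes κ t α s μ ρ = 0 := by
  obtain ⟨a1, a2, -⟩ := amp_of_mid (γ := rate κ μ) h1 h3
  obtain ⟨b1, b2, -⟩ := amp_of_mid (γ := rate κ μ) (t := 4 - t) (by linarith) (by linarith)
  simp only [waveRes, wavePot, waveSum, waveSumT, waveSumTT, a1, a2, b1, b2, cutW_of_le h3.le,
    cutW_of_le (show 4 - t ≤ 3 by linarith), deriv_phase hs, deriv_deriv_phase hs,
    deriv_cutW_of_lt h3, deriv_deriv_cutW_of_lt h3]
  simp only [rate, phaseRate]
  ring

lemma waveSum_of_lt {κ t α s μ : ℝ} (h : t < 1 / 4) : waveSum κ t α s μ = Real.cos α := by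
  simp [waveSum, (amp_of_lt (γ := rate κ μ) h).1,
    (amp_of_gt (γ := rate κ μ) (t := 4 - t) (by linarith)).1]

lemma waveRes_of_lt {κ t α s μ ρ : ℝ} (h : t < 1 / 4) : waveRes κ t α s μ ρ = 0 := by
  obtain ⟨a0, a1, a2⟩ := amp_of_lt (γ := rate κ μ) h
  obtain ⟨b0, b1, b2⟩ := amp_of_gt (γ := rate κ μ) (t := 4 - t) (by linarith)
  simp [waveRes, wavePot, waveSum, waveSumT, waveSumTT, a0, a1, a2, b0, b1, b2,
    cutW_of_le (show t ≤ 3 by linarith), cutW_of_ge (show 7 / 2 ≤ 4 - t by linarith)]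

lemma waveSum_of_gt {κ t α s μ : ℝ} (h : 15 / 4 < t) : waveSum κ t α s μ = Real.cos (α + s) := by
  simp [waveSum, phaseTwo, (amp_of_lt (γ := rate κ μ) (t := 4 - t) (by linarith)).1,
    (amp_of_gt (γ := rate κ μ) (t := t) (by linarith)).1, cutW_of_ge (show 7 / 2 ≤ t by linarith)]

lemma waveRes_of_gt {κ t α s μ ρ : ℝ} (h : 15 / 4 < t) : waveRes κ t α s μ ρ = 0 := by
  obtain ⟨a0, a1, a2⟩ := amp_of_lt (γ := rate κ μ) (t := 4 - t) (by linarith)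
  obtain ⟨b0, b1, b2⟩ := amp_of_gt (γ := rate κ μ) (t := t) (by linarith)
  simp [waveRes, wavePot, waveSum, waveSumT, waveSumTT, a0, a1, a2, b0, b1, b2,
    cutW_of_ge (show 7 / 2 ≤ t by linarith), deriv_cutW_of_gt (show 7 / 2 < t by linarith),
    deriv_deriv_cutW_of_gt (show 7 / 2 < t by linarith)]
  ring

lemma wave_of_lt {κ t α s μ ρ : ℝ} (h : t < 1 / 4) : wave κ t α s μ ρ = Real.cos α := by
  simp [wave, waveCorr, waveRes_of_lt h, waveSum_of_lt h]

lemma wave_of_gt {κ t α s μ ρ : ℝ} (h : 15 / 4 < t) :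
    wave κ t α s μ ρ = Real.cos (α + s) := by
  simp [wave, waveCorr, waveRes_of_gt h, waveSum_of_gt h]

lemma wave_add_left (κ t α s μ ρ : ℝ) : wave κ t (α + 2 * π) s μ ρ = wave κ t α s μ ρ := by
  have h : phaseTwo κ t (α + 2 * π) s μ = phaseTwo κ t α s μ + 2 * π := by
    simp only [phaseTwo]; ring
  simp [wave, waveCorr, waveRes, waveGram, waveSum, waveSumA, waveSumS, waveSumT, waveSumTT, h]

lemma wave_add_right (κ t α s μ ρ : ℝ) : wave κ t α (s + 2 * π) μ ρ = wave κ t α s μ ρ := by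
  have h : phaseTwo κ t α (s + 2 * π) μ = phaseTwo κ t α s μ + 2 * π := by
    simp only [phaseTwo, phase_periodic (phaseRate κ) s]; ring
  simp [wave, waveCorr, waveRes, waveGram, waveSum, waveSumA, waveSumS, waveSumT, waveSumTT, h,
    phaseSlope, phase_periodic (phaseRate κ) s, (phase_periodic (phaseRate κ)).deriv_real s,
    (phase_periodic (phaseRate κ)).deriv_real.deriv_real s]

lemma waveGram_zero_pos {κ t α s ρ : ℝ} (hst : ¬ (1 < t ∧ t < 3 ∧ Real.cos s < -(4 / 5)))
    (hρ : 1 / 2 ≤ ρ) (hρ' : ρ ≤ 7 / 2) : 0 < waveGram κ t α s 0 ρ := by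
  have hβ : phaseTwo κ t α s 0 = α + s := by simp [phaseTwo]
  have hr : rate κ 0 = 4 := by simp [rate]
  set b := amp 4 t with hb
  set c := amp 4 (4 - t) with hc
  have e : waveGram κ t α s 0 ρ = (b * Real.sin α) ^ 2 + (c * Real.sin (α + s)) ^ 2
      + (2 - ρ) * ((b * Real.sin α) * (c * Real.sin (α + s)))
      + (b * Real.cos α + c * Real.cos (α + s)) ^ 2 := by
    simp only [waveGram, waveSumA, waveSumS, waveSum, hβ, hr, invT, phaseSlope, ← hb, ← hc]
    ring
  have hbn : 0 ≤ b := amp_nonneg _ _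
  have hcn : 0 ≤ c := amp_nonneg _ _
  rw [e]
  set x := b * Real.sin α
  set y := c * Real.sin (α + s)
  set z := b * Real.cos α + c * Real.cos (α + s) with hz
  have key : x ^ 2 + y ^ 2 + (2 - ρ) * (x * y) ≥ (x ^ 2 + y ^ 2) / 4 := by
    nlinarith [mul_nonneg (sub_nonneg.2 hρ) (sq_nonneg (x + y)),
      mul_nonneg (sub_nonneg.2 hρ') (sq_nonneg (x + y)),
      mul_nonneg (sub_nonneg.2 hρ) (sq_nonneg (x - y)),
      mul_nonneg (sub_nonneg.2 hρ') (sq_nonneg (x - y))]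
  by_contra hneg
  have hx : x = 0 := by nlinarith [sq_nonneg x, sq_nonneg y, sq_nonneg z]
  have hy : y = 0 := by nlinarith [sq_nonneg x, sq_nonneg y, sq_nonneg z]
  have hz0 : z = 0 := by nlinarith [sq_nonneg x, sq_nonneg y, sq_nonneg z]
  have hbc : b ^ 2 = c ^ 2 := by
    have h1 : b ^ 2 = (b * Real.sin α) ^ 2 + (b * Real.cos α) ^ 2 := by
      linear_combination (- b ^ 2) * Real.sin_sq_add_cos_sq α
    have h2 : c ^ 2 = (c * Real.sin (α + s)) ^ 2 + (c * Real.cos (α + s)) ^ 2 := by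
      linear_combination (- c ^ 2) * Real.sin_sq_add_cos_sq (α + s)
    rw [h1, h2, show b * Real.sin α = 0 from hx, show c * Real.sin (α + s) = 0 from hy,
      show b * Real.cos α = -(c * Real.cos (α + s)) by linarith]
    ring
  have hbc' : b = c := (sq_eq_sq₀ hbn hcn).mp hbc
  rcases le_or_gt t 1 with h1 | h1
  · linarith [one_le_amp (γ := 4) (by norm_num) h1,
      amp_lt_one (γ := 4) (t := 4 - t) (by norm_num) (by linarith)]
  rcases le_or_gt 3 t with h3 | h3
  · linarith [one_le_amp (γ := 4) (t := 4 - t) (by norm_num) (by linarith),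
      amp_lt_one (γ := 4) (t := t) (by norm_num) (by linarith)]
  have hb0 : b ≠ 0 := (amp_of_mid (γ := 4) h1 h3).2.2.ne'
  have hc0 : c ≠ 0 := hbc' ▸ hb0
  have hsα : Real.sin α = 0 := (mul_eq_zero.mp hx).resolve_left hb0
  have hsβ : Real.sin (α + s) = 0 := (mul_eq_zero.mp hy).resolve_left hc0
  have hcc : Real.cos (α + s) = -Real.cos α := by
    have : b * (Real.cos α + Real.cos (α + s)) = 0 := by
      rw [← hz0, hz, ← hbc']; ring
    linarith [(mul_eq_zero.mp this).resolve_left hb0]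
  have hcs : Real.cos s = -1 := by
    have h := Real.cos_sub (α + s) α
    rw [add_sub_cancel_left, hsβ, hcc] at h
    rw [h]
    nlinarith [Real.sin_sq_add_cos_sq α]
  exact hst ⟨h1, h3, by rw [hcs]; norm_num⟩

lemma isOpen_middle {Y : Type*} [TopologicalSpace Y] {f g : Y → ℝ} (hf : Continuous f)
    (hg : Continuous g) : IsOpen {y | 1 < f y ∧ f y < 3 ∧ Real.cos (g y) < -(4 / 5)} :=
  (isOpen_lt continuous_const hf).inter ((isOpen_lt hf continuous_const).inter
    (isOpen_lt (Real.continuous_cos.comp hg) continuous_const))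

lemma exists_waveGram_pos (κ : ℝ) : ∃ μ₁ > 0, ∀ μ, 0 ≤ μ → μ ≤ μ₁ →
    ∀ t ∈ Set.Icc (0 : ℝ) 4, ∀ α ∈ Set.Icc (0 : ℝ) (2 * π), ∀ s ∈ Set.Icc (0 : ℝ) (2 * π),
    ∀ ρ ∈ Set.Icc (1 / 2 : ℝ) (7 / 2), ¬ (1 < t ∧ t < 3 ∧ Real.cos s < -(4 / 5)) →
    0 < waveGram κ t α s μ ρ := by
  let K : Set (ℝ × ℝ × ℝ × ℝ) := (Set.Icc 0 4 ×ˢ Set.Icc 0 (2 * π) ×ˢ Set.Icc 0 (2 * π) ×ˢ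
    Set.Icc (1 / 2) (7 / 2)) ∩ {y | 1 < y.1 ∧ y.1 < 3 ∧ Real.cos y.2.2.1 < -(4 / 5)}ᶜ
  have hK : IsCompact K := by
    refine (isCompact_Icc.prod (isCompact_Icc.prod (isCompact_Icc.prod isCompact_Icc))).inter_right
      (IsOpen.isClosed_compl ?_)
    exact isOpen_middle (f := fun y : ℝ × ℝ × ℝ × ℝ => y.1) (g := fun y => y.2.2.1)
      (by fun_prop) (by fun_prop)
  have hev : ∀ᶠ μ in 𝓝 (0 : ℝ), ∀ y ∈ K, 0 < waveGram κ y.1 y.2.1 y.2.2.1 μ y.2.2.2 := by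
    apply hK.eventually_forall_of_forall_eventually
    rintro ⟨t, α, s, ρ⟩ ⟨⟨ht, hα, hs, hρ⟩, hn⟩
    have hc : ContDiffAt ℝ (⊤ : ℕ∞) (fun z : ℝ × ℝ × ℝ × ℝ × ℝ =>
        waveGram κ z.2.1 z.2.2.1 z.2.2.2.1 z.1 z.2.2.2.2) (0, t, α, s, ρ) :=
      ContDiffAt.waveGram κ (by fun_prop) (by fun_prop) (by fun_prop) (by fun_prop)
        (by fun_prop) (by simp)
    exact hc.continuousAt.eventually (lt_mem_nhds (waveGram_zero_pos hn hρ.1 hρ.2))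
  obtain ⟨δ, hδ, h⟩ := Metric.eventually_nhds_iff.mp hev
  refine ⟨δ / 2, half_pos hδ, fun μ h0 h1 t ht α hα s hs ρ hρ hn => ?_⟩
  exact h (y := μ) (by rw [Real.dist_eq, sub_zero, abs_of_nonneg h0]; linarith) (t, α, s, ρ)
    ⟨⟨ht, hα, hs, hρ⟩, hn⟩

/-- The compact range of the local coordinates `(t, α, s, μ, ρ)`. -/
def waveBox (μ₁ : ℝ) : Set (ℝ × ℝ × ℝ × ℝ × ℝ) :=
  Set.Icc 0 4 ×ˢ Set.Icc 0 (2 * π) ×ˢ Set.Icc 0 (2 * π) ×ˢ Set.Icc 0 μ₁ ×ˢ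
    Set.Icc (1 / 2) (7 / 2)

lemma isCompact_waveBox (μ₁ : ℝ) : IsCompact (waveBox μ₁) :=
  isCompact_Icc.prod (isCompact_Icc.prod (isCompact_Icc.prod (isCompact_Icc.prod isCompact_Icc)))

/-- The corrector as a function of the tuple of local coordinates. -/
noncomputable def waveCorrTuple (κ : ℝ) (q : ℝ × ℝ × ℝ × ℝ × ℝ) : ℝ :=
  waveCorr κ q.1 q.2.1 q.2.2.1 q.2.2.2.1 q.2.2.2.2

lemma invT_denom_pos {t μ ρ : ℝ} (ht : 0 ≤ t) (hμ : 0 ≤ μ) (hρ : 0 ≤ ρ) :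
    0 < 1 + μ * ρ * t := by positivity

lemma contDiffAt_waveCorrTuple {κ t α s μ ρ : ℝ} (ht : 0 ≤ t) (hμ : 0 ≤ μ) (hρ : 0 ≤ ρ)
    (h : ¬ (1 < t ∧ t < 3 ∧ Real.cos s < -(4 / 5)) → 0 < waveGram κ t α s μ ρ) :
    ContDiffAt ℝ (⊤ : ℕ∞) (waveCorrTuple κ) (t, α, s, μ, ρ) := by
  have h0 := (invT_denom_pos ht hμ hρ).ne'
  by_cases hm : 1 < t ∧ t < 3 ∧ Real.cos s < -(4 / 5)
  · have hU : IsOpen {q : ℝ × ℝ × ℝ × ℝ × ℝ | 1 < q.1 ∧ q.1 < 3 ∧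
        Real.cos q.2.2.1 < -(4 / 5)} :=
      isOpen_middle (by fun_prop) (by fun_prop)
    have : waveCorrTuple κ =ᶠ[𝓝 (t, α, s, μ, ρ)] fun _ => 0 := by
      filter_upwards [hU.mem_nhds hm] with q hq
      rw [waveCorrTuple, waveCorr, waveRes_of_mid hq.1 hq.2.1 hq.2.2, zero_div]
    exact contDiffAt_const.congr_of_eventuallyEq this
  · unfold waveCorrTuple waveCorr
    refine ContDiffAt.div (ContDiffAt.waveRes κ (by fun_prop) (by fun_prop) (by fun_prop)
      (by fun_prop) (by fun_prop) h0) (contDiffAt_const.mul (ContDiffAt.waveGram κ (by fun_prop)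
      (by fun_prop) (by fun_prop) (by fun_prop) (by fun_prop) h0)) ?_
    exact mul_ne_zero two_ne_zero (h hm).ne'

lemma two_mul_waveCorr_mul_waveGram {κ t α s μ ρ : ℝ}
    (h : ¬ (1 < t ∧ t < 3 ∧ Real.cos s < -(4 / 5)) → 0 < waveGram κ t α s μ ρ) :
    2 * waveCorr κ t α s μ ρ * waveGram κ t α s μ ρ = waveRes κ t α s μ ρ := by
  by_cases hm : 1 < t ∧ t < 3 ∧ Real.cos s < -(4 / 5)
  · simp [waveCorr, waveRes_of_mid hm.1 hm.2.1 hm.2.2]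
  · have := (h hm).ne'
    rw [waveCorr]; field_simp

/-- A uniform bound for the ingredients of the local model at a point. -/
structure WaveBound (κ M t α s μ ρ : ℝ) : Prop where
  pot : |wavePot κ t μ ρ| ≤ M
  res : |waveRes κ t α s μ ρ| ≤ M
  sum : |waveSum κ t α s μ| ≤ M
  sumT : |waveSumT κ t α s μ| ≤ M
  sumA : |waveSumA κ t α s μ| ≤ M
  sumS : |waveSumS κ t α s μ| ≤ M
  corr : |waveCorr κ t α s μ ρ| ≤ M
  corr_fderiv : ‖fderiv ℝ (waveCorrTuple κ) (t, α, s, μ, ρ)‖ ≤ M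
  corr_fderiv_fderiv : ‖fderiv ℝ (fderiv ℝ (waveCorrTuple κ)) (t, α, s, μ, ρ)‖ ≤ M

lemma exists_waveBound {κ μ₁ : ℝ}
    (h : ∀ μ, 0 ≤ μ → μ ≤ μ₁ →
      ∀ t ∈ Set.Icc (0 : ℝ) 4, ∀ α ∈ Set.Icc (0 : ℝ) (2 * π), ∀ s ∈ Set.Icc (0 : ℝ) (2 * π),
      ∀ ρ ∈ Set.Icc (1 / 2 : ℝ) (7 / 2), ¬ (1 < t ∧ t < 3 ∧ Real.cos s < -(4 / 5)) →
      0 < waveGram κ t α s μ ρ) :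
    ∃ M > 0, ∀ μ, 0 ≤ μ → μ ≤ μ₁ →
      ∀ t ∈ Set.Icc (0 : ℝ) 4, ∀ α ∈ Set.Icc (0 : ℝ) (2 * π), ∀ s ∈ Set.Icc (0 : ℝ) (2 * π),
      ∀ ρ ∈ Set.Icc (1 / 2 : ℝ) (7 / 2), WaveBound κ M t α s μ ρ := by
  have hcorr : ∀ q ∈ waveBox μ₁, ContDiffAt ℝ (⊤ : ℕ∞) (waveCorrTuple κ) q := by
    rintro ⟨t, α, s, μ, ρ⟩ ⟨ht, hα, hs, hμ, hρ⟩
    exact contDiffAt_waveCorrTuple ht.1 hμ.1 (le_trans (by norm_num) hρ.1)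
      (h μ hμ.1 hμ.2 t ht α hα s hs ρ hρ)
  have hbd : ∀ {G : Type} [NormedAddCommGroup G] (g : ℝ × ℝ × ℝ × ℝ × ℝ → G),
      (∀ q ∈ waveBox μ₁, ContinuousAt g q) → ∃ M, ∀ q ∈ waveBox μ₁, ‖g q‖ ≤ M := by
    intro G _ g hg
    exact (isCompact_waveBox μ₁).exists_bound_of_continuousOn
      fun q hq => (hg q hq).continuousWithinAt
  have hcd : ∀ (g : ℝ × ℝ × ℝ × ℝ × ℝ → ℝ),
      (∀ q ∈ waveBox μ₁, ContDiffAt ℝ (⊤ : ℕ∞) g q) → ∃ M, ∀ q ∈ waveBox μ₁, ‖g q‖ ≤ M :=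
    fun g hg => hbd g fun q hq => (hg q hq).continuousAt
  have hd : ∀ q ∈ waveBox μ₁, 1 + q.2.2.2.1 * q.2.2.2.2 * q.1 ≠ 0 := by
    rintro ⟨t, α, s, μ, ρ⟩ ⟨ht, hα, hs, hμ, hρ⟩
    exact (invT_denom_pos ht.1 hμ.1 (le_trans (by norm_num) hρ.1)).ne'
  obtain ⟨M1, h1⟩ := hcd (fun q => wavePot κ q.1 q.2.2.2.1 q.2.2.2.2) (by
    intro q hq
    have := ContDiffAt.invT (x := q) (t := fun q => q.1) (μ := fun q => q.2.2.2.1)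
      (ρ := fun q => q.2.2.2.2) (by fun_prop) (by fun_prop) (by fun_prop) (hd q hq)
    unfold wavePot; fun_prop)
  obtain ⟨M2, h2⟩ := hcd (fun q => waveRes κ q.1 q.2.1 q.2.2.1 q.2.2.2.1 q.2.2.2.2)
    fun q hq => ContDiffAt.waveRes κ (by fun_prop) (by fun_prop) (by fun_prop) (by fun_prop)
      (by fun_prop) (hd q hq)
  obtain ⟨M3, h3⟩ := hcd (fun q => waveSum κ q.1 q.2.1 q.2.2.1 q.2.2.2.1)
    fun q hq => by fun_prop
  obtain ⟨M4, h4⟩ := hcd (fun q => waveSumT κ q.1 q.2.1 q.2.2.1 q.2.2.2.1)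
    fun q hq => by fun_prop
  obtain ⟨M5, h5⟩ := hcd (fun q => waveSumA κ q.1 q.2.1 q.2.2.1 q.2.2.2.1)
    fun q hq => by fun_prop
  obtain ⟨M6, h6⟩ := hcd (fun q => waveSumS κ q.1 q.2.1 q.2.2.1 q.2.2.2.1)
    fun q hq => by fun_prop
  obtain ⟨M7, h7⟩ := hcd (waveCorrTuple κ) hcorr
  obtain ⟨M8, h8⟩ := hbd (fderiv ℝ (waveCorrTuple κ)) fun q hq =>
    ((hcorr q hq).fderiv_right (m := (⊤ : ℕ∞)) (by simp)).continuousAt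
  obtain ⟨M9, h9⟩ := hbd (fderiv ℝ (fderiv ℝ (waveCorrTuple κ))) fun q hq =>
    (((hcorr q hq).fderiv_right (m := (⊤ : ℕ∞)) (by simp)).fderiv_right
      (m := (⊤ : ℕ∞)) (by simp)).continuousAt
  refine ⟨1 + |M1| + |M2| + |M3| + |M4| + |M5| + |M6| + |M7| + |M8| + |M9|, by positivity, ?_⟩
  intro μ hμ0 hμ1 t ht α hα s hs ρ hρ
  have hq : (t, α, s, μ, ρ) ∈ waveBox μ₁ := ⟨ht, hα, hs, ⟨hμ0, hμ1⟩, hρ⟩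
  have a1 := abs_nonneg M1
  have a2 := abs_nonneg M2
  have a3 := abs_nonneg M3
  have a4 := abs_nonneg M4
  have a5 := abs_nonneg M5
  have a6 := abs_nonneg M6
  have a7 := abs_nonneg M7
  have a8 := abs_nonneg M8
  have a9 := abs_nonneg M9
  constructor
  · exact (h1 _ hq).trans (by linarith [le_abs_self M1])
  · exact (h2 _ hq).trans (by linarith [le_abs_self M2])
  · exact (h3 _ hq).trans (by linarith [le_abs_self M3])
  · exact (h4 _ hq).trans (by linarith [le_abs_self M4])
  · exact (h5 _ hq).trans (by linarith [le_abs_self M5])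
  · exact (h6 _ hq).trans (by linarith [le_abs_self M6])
  · exact (h7 _ hq).trans (by linarith [le_abs_self M7])
  · exact (h8 _ hq).trans (by linarith [le_abs_self M8])
  · exact (h9 _ hq).trans (by linarith [le_abs_self M9])

lemma HasTwoJetAt.sub_mul_sq_mul {u v : ℝ → ℝ} {x a b c d : ℝ} (ε : ℝ)
    (hu : HasTwoJetAt u x a b) (hv : HasTwoJetAt v x c d) :
    HasTwoJetAt (fun τ => u τ - ε * u τ ^ 2 * v τ) x
      (a - ε * (2 * u x * a * v x + u x ^ 2 * c))
      (b - ε * ((2 * a ^ 2 + 2 * u x * b) * v x + 4 * (u x * (a * c)) + u x ^ 2 * d)) := by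
  refine ((hu.add (((hu.mul hu).mul hv).const_mul (-ε))).congr ?_).congr_jet ?_ ?_
  · exact Eventually.of_forall fun τ => by ring
  · ring
  · ring

lemma abs_fderiv_apply_le {E : Type*} [NormedAddCommGroup E] [NormedSpace ℝ E] {f : E → ℝ}
    {q v : E} {M : ℝ} (h : ‖fderiv ℝ f q‖ ≤ M) : |fderiv ℝ f q v| ≤ M * ‖v‖ :=
  (ContinuousLinearMap.le_opNorm _ v).trans (mul_le_mul_of_nonneg_right h (norm_nonneg v))

lemma abs_fderiv_fderiv_apply_le {E : Type*} [NormedAddCommGroup E] [NormedSpace ℝ E]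
    {f : E → ℝ} {q v : E} {M : ℝ} (h : ‖fderiv ℝ (fderiv ℝ f) q‖ ≤ M) :
    |fderiv ℝ (fderiv ℝ f) q v v| ≤ M * ‖v‖ ^ 2 := by
  have h1 := ContinuousLinearMap.le_opNorm₂ (fderiv ℝ (fderiv ℝ f) q) v v
  calc |fderiv ℝ (fderiv ℝ f) q v v| ≤ ‖fderiv ℝ (fderiv ℝ f) q‖ * ‖v‖ * ‖v‖ := h1
    _ = ‖fderiv ℝ (fderiv ℝ f) q‖ * ‖v‖ ^ 2 := by ring
    _ ≤ M * ‖v‖ ^ 2 := by gcongr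

lemma norm_line_sq_le (ξ η : ℝ) :
    ‖((0, ξ, η, 0, 0) : ℝ × ℝ × ℝ × ℝ × ℝ)‖ ^ 2 ≤ ξ ^ 2 + η ^ 2 := by
  have h : ‖((0, ξ, η, 0, 0) : ℝ × ℝ × ℝ × ℝ × ℝ)‖ = max |ξ| |η| := by
    simp [Prod.norm_def]
  rw [h]
  rcases max_cases |ξ| |η| with ⟨h, -⟩ | ⟨h, -⟩ <;> rw [h, sq_abs] <;>
    nlinarith [sq_nonneg ξ, sq_nonneg η]

lemma hasTwoJetAt_waveCorr_t {κ t α s μ ρ : ℝ}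
    (h : ContDiffAt ℝ (⊤ : ℕ∞) (waveCorrTuple κ) (t, α, s, μ, ρ)) :
    HasTwoJetAt (fun τ => waveCorr κ (t + τ) α s μ ρ) 0
      (fderiv ℝ (waveCorrTuple κ) (t, α, s, μ, ρ) (1, 0, 0, 0, 0))
      (fderiv ℝ (fderiv ℝ (waveCorrTuple κ)) (t, α, s, μ, ρ) (1, 0, 0, 0, 0) (1, 0, 0, 0, 0)) := by
  have h2 : ContDiffAt ℝ 2 (waveCorrTuple κ) (t, α, s, μ, ρ) :=
    h.of_le (WithTop.coe_le_coe.2 (le_top : (2 : ℕ∞) ≤ ⊤))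
  refine (HasTwoJetAt.of_contDiffAt h2 (1, 0, 0, 0, 0)).congr ?_
  exact Eventually.of_forall fun τ => by simp [waveCorrTuple]

lemma hasTwoJetAt_waveCorr_line {κ t α s μ ρ : ℝ} (ξ η : ℝ)
    (h : ContDiffAt ℝ (⊤ : ℕ∞) (waveCorrTuple κ) (t, α, s, μ, ρ)) :
    HasTwoJetAt (fun τ => waveCorr κ t (α + ξ * τ) (s + η * τ) μ ρ) 0
      (fderiv ℝ (waveCorrTuple κ) (t, α, s, μ, ρ) (0, ξ, η, 0, 0))
      (fderiv ℝ (fderiv ℝ (waveCorrTuple κ)) (t, α, s, μ, ρ) (0, ξ, η, 0, 0) (0, ξ, η, 0, 0)) := by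
  have h2 : ContDiffAt ℝ 2 (waveCorrTuple κ) (t, α, s, μ, ρ) :=
    h.of_le (WithTop.coe_le_coe.2 (le_top : (2 : ℕ∞) ≤ ⊤))
  refine (HasTwoJetAt.of_contDiffAt h2 (0, ξ, η, 0, 0)).congr ?_
  exact Eventually.of_forall fun τ => by simp [waveCorrTuple, mul_comm]

/-- The operator `T - 2κ∂ₜ + (κ²/T)∂ₜ² + Σᵢ ∂ᵢ²` applied to `wave`, in terms of the jets of the
corrector. -/
lemma wave_laplacian_identity {κ t α s μ ρ ht htt : ℝ} {ι : Type*} [Fintype ι] (ξ η c d : ι → ℝ)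
    (hμ : 0 < μ) (hρ : 0 < ρ) (ht0 : 0 ≤ t)
    (hG : 2 * waveCorr κ t α s μ ρ * waveGram κ t α s μ ρ = waveRes κ t α s μ ρ)
    (h11 : ∑ i, ξ i ^ 2 = 1 / (μ * ρ)) (h12 : ∑ i, ξ i * η i = (4 - 1 / μ) / 2)
    (h22 : ∑ i, η i ^ 2 = 1 / μ) (a b : ι → ℝ)
    (ha : ∀ i, a i = waveSumA κ t α s μ * ξ i + waveSumS κ t α s μ * η i)
    (hb : ∀ i, b i = -waveSum κ t α s μ * ξ i ^ 2
        - 2 * amp (rate κ μ) (4 - t) * Real.cos (phaseTwo κ t α s μ) * phaseSlope κ t s μ *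
          (ξ i * η i)
        - amp (rate κ μ) (4 - t) * (Real.cos (phaseTwo κ t α s μ) * phaseSlope κ t s μ ^ 2
          + Real.sin (phaseTwo κ t α s μ) * (μ * cutW t * deriv (deriv (phase (phaseRate κ))) s)) *
          η i ^ 2)
    {X XT XTT H R V ε T : ℝ} (hX : X = waveSum κ t α s μ) (hXT : XT = waveSumT κ t α s μ)
    (hXTT : XTT = waveSumTT κ t α s μ) (hH : H = waveCorr κ t α s μ ρ)
    (hR : R = waveRes κ t α s μ ρ) (hV : V = wavePot κ t μ ρ) (hε : ε = μ * ρ)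
    (hT : T = t + 1 / (μ * ρ)) :
    T * (X - ε * X ^ 2 * H) - 2 * κ * (XT - ε * (2 * X * XT * H + X ^ 2 * ht))
      + κ ^ 2 / T * (XTT - ε * ((2 * XT ^ 2 + 2 * X * XTT) * H + 4 * (X * (XT * ht))
        + X ^ 2 * htt))
      + ∑ i, (b i - ε * ((2 * a i ^ 2 + 2 * X * b i) * H + 4 * (X * (a i * c i)) + X ^ 2 * d i))
    = V * (X - ε * X ^ 2 * H) + X * (2 * H * X - 2 * ε * H * R + ε * H * (T - V) * X
        - 4 * (ε * ∑ i, a i * c i + ε * (κ ^ 2 / T) * (XT * ht))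
        - X * (ε * ∑ i, d i - 2 * κ * ε * ht + ε * (κ ^ 2 / T) * htt)) := by
  have hT0 : T ≠ 0 := by rw [hT]; positivity
  have hιT : invT t μ ρ = 1 / T := by
    rw [hT, invT]
    have := (invT_denom_pos ht0 hμ.le hρ.le).ne'
    field_simp
    ring
  set S := ∑ i, b i with hS
  set Q := ∑ i, a i ^ 2 with hQ
  have hQ' : ε * Q + ε * (κ ^ 2 / T) * XT ^ 2 = waveGram κ t α s μ ρ - X ^ 2 := by
    have : Q = waveSumA κ t α s μ ^ 2 * ∑ i, ξ i ^ 2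
        + 2 * waveSumA κ t α s μ * waveSumS κ t α s μ * ∑ i, ξ i * η i
        + waveSumS κ t α s μ ^ 2 * ∑ i, η i ^ 2 := by
      rw [hQ, Finset.mul_sum, Finset.mul_sum, Finset.mul_sum, ← Finset.sum_add_distrib,
        ← Finset.sum_add_distrib]
      exact Finset.sum_congr rfl fun i _ => by rw [ha]; ring
    rw [this, h11, h12, h22, waveGram, hιT, hε, hXT, hX]
    field_simp
    ring
  have hS' : S - 2 * κ * XT + κ ^ 2 / T * XTT = R - (T - V) * X := by
    have : S = -waveSum κ t α s μ * ∑ i, ξ i ^ 2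
        - 2 * amp (rate κ μ) (4 - t) * Real.cos (phaseTwo κ t α s μ) * phaseSlope κ t s μ *
          ∑ i, ξ i * η i
        - amp (rate κ μ) (4 - t) * (Real.cos (phaseTwo κ t α s μ) * phaseSlope κ t s μ ^ 2
          + Real.sin (phaseTwo κ t α s μ) * (μ * cutW t * deriv (deriv (phase (phaseRate κ))) s)) *
          ∑ i, η i ^ 2 := by
      rw [hS, Finset.mul_sum, Finset.mul_sum, Finset.mul_sum, ← Finset.sum_sub_distrib,
        ← Finset.sum_sub_distrib]
      exact Finset.sum_congr rfl fun i _ => by rw [hb]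
    rw [this, h11, h12, h22, hR, waveRes, hιT, hV, hXT, hXTT, hX, phaseSlope]
    have e : T - t = 1 / (μ * ρ) := by rw [hT]; ring
    have e2 : μ * (1 / μ) = 1 := by field_simp
    set z := 1 / μ
    set y := 1 / (μ * ρ)
    linear_combination waveSum κ t α s μ * e - amp (rate κ μ) (4 - t) *
      (Real.cos (phaseTwo κ t α s μ) * (cutW t * deriv (phase (phaseRate κ)) s) *
        (1 + μ * cutW t * deriv (phase (phaseRate κ)) s) + Real.sin (phaseTwo κ t α s μ) *
        (cutW t * deriv (deriv (phase (phaseRate κ))) s)) * e2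
  have hsum : ∑ i, (b i - ε * ((2 * a i ^ 2 + 2 * X * b i) * H + 4 * (X * (a i * c i))
      + X ^ 2 * d i)) = S - ε * ((2 * Q + 2 * X * S) * H + 4 * (X * ∑ i, a i * c i)
      + X ^ 2 * ∑ i, d i) := by
    simp only [Finset.sum_sub_distrib, ← Finset.mul_sum, Finset.sum_add_distrib, ← Finset.sum_mul,
      hS, hQ]
  rw [hsum]
  rw [← hH, ← hR] at hG
  linear_combination (1 - 2 * ε * X * H) * hS' - 2 * H * hQ' - hG

lemma abs_mul_le_mul {a b A B : ℝ} (ha : |a| ≤ A) (hb : |b| ≤ B) : |a * b| ≤ A * B := by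
  rw [abs_mul]
  exact mul_le_mul ha hb (abs_nonneg b) ((abs_nonneg a).trans ha)

/-- Uniform regularity and the differential inequality of `wave` at the point `(t, α, s)`. -/
structure WaveEstimate (κ C t α s μ ρ : ℝ) : Prop where
  smooth : ContDiffAt ℝ (⊤ : ℕ∞) (fun q : ℝ × ℝ × ℝ => wave κ q.1 q.2.1 q.2.2 μ ρ) (t, α, s)
  bound : |wave κ t α s μ ρ| ≤ C
  jets : ∃ u v, HasTwoJetAt (fun τ => wave κ (t + τ) α s μ ρ) 0 u v ∧
    ∀ {d : ℕ} (ξ η : Fin d → ℝ), ∑ i, ξ i ^ 2 = 1 / (μ * ρ) →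
      ∑ i, ξ i * η i = (4 - 1 / μ) / 2 → ∑ i, η i ^ 2 = 1 / μ →
      ∃ a b : Fin d → ℝ,
        (∀ i, HasTwoJetAt (fun τ => wave κ t (α + ξ i * τ) (s + η i * τ) μ ρ) 0 (a i) (b i)) ∧
        |(t + 1 / (μ * ρ)) * wave κ t α s μ ρ - 2 * κ * u + κ ^ 2 / (t + 1 / (μ * ρ)) * v
          + ∑ i, b i| ≤ C * |wave κ t α s μ ρ|

lemma wave_residual_bound {κ M ε T V X XT H R ht htt P Q t : ℝ} (hκ : 0 < κ) (hM : 0 < M)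
    (hε : 0 < ε) (hε1 : ε ≤ 1 / 2) (hT : T = t + 1 / ε) (ht0 : 0 ≤ t) (ht4 : t ≤ 4)
    (hV : |V| ≤ M) (hX : |X| ≤ M) (hXT : |XT| ≤ M) (hH : |H| ≤ M) (hR : |R| ≤ M)
    (h1 : |ht| ≤ M) (h2 : |htt| ≤ M) (hP : |ε * P| ≤ 9 * M ^ 2) (hQ : |ε * Q| ≤ 5 * M) :
    |2 * H * X - 2 * ε * H * R + ε * H * (T - V) * X
        - 4 * (ε * P + ε * (κ ^ 2 / T) * (XT * ht))
        - X * (ε * Q - 2 * κ * ε * ht + ε * (κ ^ 2 / T) * htt)|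
      ≤ (47 + M + 5 * κ ^ 2 + κ) * M ^ 2 := by
  have hTε : 1 / ε ≤ T := by rw [hT]; linarith
  have hε2 : 2 ≤ 1 / ε := by rw [le_div_iff₀ hε]; linarith
  have hεa : |ε| ≤ 1 / 2 := by rwa [abs_of_pos hε]
  have hεT : |ε * (κ ^ 2 / T)| ≤ κ ^ 2 := by
    have hT0 : 0 < T := by linarith
    rw [abs_of_pos (by positivity), ← mul_div_assoc, div_le_iff₀ hT0]
    nlinarith [sq_nonneg κ]
  have b1 : |2 * (H * X)| ≤ 2 * (M * M) :=
    abs_mul_le_mul (by norm_num) (abs_mul_le_mul hH hX)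
  have b2 : |2 * (ε * (H * R))| ≤ 2 * (1 / 2 * (M * M)) :=
    abs_mul_le_mul (by norm_num) (abs_mul_le_mul hεa (abs_mul_le_mul hH hR))
  have hTV : |ε * (T - V)| ≤ 3 + M := by
    have e : ε * (T - V) = 1 + ε * t - ε * V := by
      rw [hT]; field_simp; ring
    have e1 := abs_mul_le_mul hεa hV
    rw [abs_le] at e1 ⊢
    rw [e]
    constructor <;> nlinarith
  have b3 : |ε * (T - V) * (H * X)| ≤ (3 + M) * (M * M) :=
    abs_mul_le_mul hTV (abs_mul_le_mul hH hX)
  have b4 : |ε * (κ ^ 2 / T) * (XT * ht)| ≤ κ ^ 2 * (M * M) :=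
    abs_mul_le_mul hεT (abs_mul_le_mul hXT h1)
  have b5 : |X * (ε * Q)| ≤ M * (5 * M) := abs_mul_le_mul hX hQ
  have b6 : |2 * κ * (ε * (X * ht))| ≤ 2 * κ * (1 / 2 * (M * M)) :=
    abs_mul_le_mul (by rw [abs_of_pos (by positivity)])
      (abs_mul_le_mul hεa (abs_mul_le_mul hX h1))
  have b7 : |ε * (κ ^ 2 / T) * (X * htt)| ≤ κ ^ 2 * (M * M) :=
    abs_mul_le_mul hεT (abs_mul_le_mul hX h2)
  rw [abs_le] at *
  constructor <;> nlinarith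

lemma waveEstimate_of_waveBound {κ M t α s μ ρ : ℝ} (hκ : 0 < κ) (hM : 0 < M)
    (hb : WaveBound κ M t α s μ ρ)
    (hG : ¬ (1 < t ∧ t < 3 ∧ Real.cos s < -(4 / 5)) → 0 < waveGram κ t α s μ ρ)
    (hμ : 0 < μ) (hμM : μ ≤ 1 / (7 * (M ^ 2 + 1))) (hρ : 1 / 2 ≤ ρ) (hρ' : ρ ≤ 7 / 2)
    (ht0 : 0 ≤ t) (ht4 : t ≤ 4) :
    WaveEstimate κ (3 * M + 2 * ((47 + M + 5 * κ ^ 2 + κ) * M ^ 2)) t α s μ ρ := by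
  have hρ0 : 0 < ρ := by linarith
  have hε0 : 0 < μ * ρ := by positivity
  have hεM : μ * ρ * (2 * (M ^ 2 + 1)) ≤ 1 := by
    have h7 : μ * (7 * (M ^ 2 + 1)) ≤ 1 := by
      rwa [le_div_iff₀ (by positivity)] at hμM
    nlinarith [mul_nonneg hμ.le (by positivity : 0 ≤ M ^ 2 + 1)]
  have hε1 : μ * ρ ≤ 1 / 2 := by nlinarith [mul_nonneg hε0.le (sq_nonneg M)]
  have hcorr := contDiffAt_waveCorrTuple ht0 hμ.le hρ0.le hG
  set X := waveSum κ t α s μ with hX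
  set H := waveCorr κ t α s μ ρ with hH
  have hf : wave κ t α s μ ρ = X - μ * ρ * X ^ 2 * H := rfl
  have hcor : |μ * ρ * X ^ 2 * H| ≤ |X| / 2 := by
    have e : μ * ρ * X ^ 2 * H = X * (μ * ρ * (X * H)) := by ring
    have h1 : |μ * ρ * (X * H)| ≤ 1 / 2 := by
      refine (abs_mul_le_mul (abs_of_pos hε0).le (abs_mul_le_mul hb.sum hb.corr)).trans ?_
      nlinarith
    rw [e, abs_mul]
    nlinarith [abs_nonneg X]
  have hlow : |X| ≤ 2 * |wave κ t α s μ ρ| := by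
    rw [hf]
    linarith [abs_sub_abs_le_abs_sub X (μ * ρ * X ^ 2 * H)]
  have hup : |wave κ t α s μ ρ| ≤ 3 * M := by
    rw [hf]
    linarith [abs_sub X (μ * ρ * X ^ 2 * H), hb.sum]
  set B := (47 + M + 5 * κ ^ 2 + κ) * M ^ 2 with hB
  have hB0 : 0 ≤ B := by positivity
  refine ⟨?_, by linarith, ?_⟩
  · have h1 : ContDiffAt ℝ (⊤ : ℕ∞)
        (fun q : ℝ × ℝ × ℝ => waveCorr κ q.1 q.2.1 q.2.2 μ ρ) (t, α, s) :=
      ContDiffAt.comp (g := waveCorrTuple κ) (f := fun q : ℝ × ℝ × ℝ => (q.1, q.2.1, q.2.2, μ, ρ))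
        (t, α, s) hcorr (by fun_prop)
    unfold wave
    fun_prop
  · have jt := (hasTwoJetAt_waveSum_t κ t α s μ).sub_mul_sq_mul (μ * ρ)
      (hasTwoJetAt_waveCorr_t hcorr)
    simp only [add_zero] at jt
    refine ⟨_, _, jt, ?_⟩
    intro d ξ η h11 h12 h22
    have jl := fun i => (hasTwoJetAt_waveSum_line κ t α s μ (ξ i) (η i)).sub_mul_sq_mul (μ * ρ)
      (hasTwoJetAt_waveCorr_line (ξ i) (η i) hcorr)
    simp only [mul_zero, add_zero] at jl
    refine ⟨_, _, jl, ?_⟩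
    rw [hf, wave_laplacian_identity ξ η _ _ hμ hρ0 ht0 (two_mul_waveCorr_mul_waveGram hG)
      h11 h12 h22 _ _ (fun _ => rfl) (fun _ => rfl) hX rfl rfl hH rfl rfl rfl rfl, ← hf]
    have hnorm1 : ‖((1, 0, 0, 0, 0) : ℝ × ℝ × ℝ × ℝ × ℝ)‖ = 1 := by simp [Prod.norm_def]
    have hsum : μ * ρ * ∑ i, (ξ i ^ 2 + η i ^ 2) ≤ 9 / 2 := by
      rw [Finset.sum_add_distrib, h11, h22]
      have : μ * ρ * (1 / (μ * ρ) + 1 / μ) = 1 + ρ := by field_simp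
      linarith
    have hc : ∀ i, |fderiv ℝ (waveCorrTuple κ) (t, α, s, μ, ρ) (0, ξ i, η i, 0, 0)| ≤
        M * (|ξ i| + |η i|) := fun i => by
      refine (abs_fderiv_apply_le hb.corr_fderiv).trans ?_
      refine mul_le_mul_of_nonneg_left (abs_le_of_sq_le_sq' ?_ (by positivity)).2 hM.le
      refine (norm_line_sq_le _ _).trans ?_
      rw [← sq_abs (ξ i), ← sq_abs (η i)]
      nlinarith [mul_nonneg (abs_nonneg (ξ i)) (abs_nonneg (η i))]
    have hres := wave_residual_bound (P := ∑ i, (waveSumA κ t α s μ * ξ i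
        + waveSumS κ t α s μ * η i) *
        fderiv ℝ (waveCorrTuple κ) (t, α, s, μ, ρ) (0, ξ i, η i, 0, 0))
      (Q := ∑ i, fderiv ℝ (fderiv ℝ (waveCorrTuple κ)) (t, α, s, μ, ρ) (0, ξ i, η i, 0, 0)
        (0, ξ i, η i, 0, 0)) hκ hM hε0 hε1 rfl ht0 ht4 hb.pot hb.sum hb.sumT hb.corr hb.res
      (by simpa [hnorm1] using abs_fderiv_apply_le (v := (1, 0, 0, 0, 0)) hb.corr_fderiv)
      (by simpa [hnorm1] using
        abs_fderiv_fderiv_apply_le (v := (1, 0, 0, 0, 0)) hb.corr_fderiv_fderiv)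
      (by
        rw [abs_mul, abs_of_pos hε0]
        calc _ ≤ μ * ρ * ∑ i, 2 * M ^ 2 * (ξ i ^ 2 + η i ^ 2) := by
              gcongr
              refine (Finset.abs_sum_le_sum_abs _ _).trans (Finset.sum_le_sum fun i _ => ?_)
              have ha : |waveSumA κ t α s μ * ξ i + waveSumS κ t α s μ * η i| ≤
                  M * (|ξ i| + |η i|) := by
                refine (abs_add_le _ _).trans ?_
                rw [mul_add]
                exact add_le_add (abs_mul_le_mul hb.sumA le_rfl) (abs_mul_le_mul hb.sumS le_rfl)
              refine (abs_mul_le_mul ha (hc i)).trans ?_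
              rw [← sq_abs (ξ i), ← sq_abs (η i)]
              nlinarith [mul_nonneg (sq_nonneg M) (sq_nonneg (|ξ i| - |η i|))]
          _ = 2 * M ^ 2 * (μ * ρ * ∑ i, (ξ i ^ 2 + η i ^ 2)) := by rw [← Finset.mul_sum]; ring
          _ ≤ 9 * M ^ 2 := by nlinarith [sq_nonneg M])
      (by
        rw [abs_mul, abs_of_pos hε0]
        calc _ ≤ μ * ρ * ∑ i, M * (ξ i ^ 2 + η i ^ 2) := by
              gcongr
              refine (Finset.abs_sum_le_sum_abs _ _).trans (Finset.sum_le_sum fun i _ => ?_)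
              exact (abs_fderiv_fderiv_apply_le hb.corr_fderiv_fderiv).trans
                (mul_le_mul_of_nonneg_left (norm_line_sq_le _ _) hM.le)
          _ = M * (μ * ρ * ∑ i, (ξ i ^ 2 + η i ^ 2)) := by rw [← Finset.mul_sum]; ring
          _ ≤ 5 * M := by nlinarith)
    refine (abs_add_le _ _).trans ?_
    have e1 := abs_mul_le_mul hb.pot (le_refl |wave κ t α s μ ρ|)
    have e2 := abs_mul_le_mul hlow hres
    refine (add_le_add e1 e2).trans ?_
    nlinarith [abs_nonneg (wave κ t α s μ ρ)]

lemma exists_wave_translate (κ α s μ ρ : ℝ) : ∃ α₀ ∈ Set.Icc (0 : ℝ) (2 * π),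
    ∃ s₀ ∈ Set.Icc (0 : ℝ) (2 * π), ∀ t x y,
      wave κ t (α + x) (s + y) μ ρ = wave κ t (α₀ + x) (s₀ + y) μ ρ := by
  have hred : ∀ z : ℝ, ∃ z₀ ∈ Set.Icc (0 : ℝ) (2 * π), ∃ n : ℤ, z = z₀ + n * (2 * π) := by
    intro z
    refine ⟨toIcoMod Real.two_pi_pos 0 z, ?_, toIcoDiv Real.two_pi_pos 0 z, ?_⟩
    · have := toIcoMod_mem_Ico Real.two_pi_pos 0 z
      rw [zero_add] at this
      exact ⟨this.1, this.2.le⟩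
    · have := toIcoMod_add_toIcoDiv_zsmul Real.two_pi_pos 0 z
      rw [zsmul_eq_mul] at this
      exact this.symm
  obtain ⟨α₀, hα₀, n, rfl⟩ := hred α
  obtain ⟨s₀, hs₀, m, rfl⟩ := hred s
  refine ⟨α₀, hα₀, s₀, hs₀, fun t x y => ?_⟩
  have h1 : Function.Periodic (fun z => wave κ t z (s₀ + m * (2 * π) + y) μ ρ) (2 * π) :=
    fun z => wave_add_left κ t z _ μ ρ
  have h2 : Function.Periodic (fun z => wave κ t (α₀ + x) z μ ρ) (2 * π) :=
    fun z => wave_add_right κ t _ z μ ρ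
  have h3 := h1.int_mul n (α₀ + x)
  have h4 := h2.int_mul m (s₀ + y)
  beta_reduce at h3 h4
  rw [add_right_comm, h3, add_right_comm s₀, h4]

lemma WaveEstimate.translate {κ C t α s α₀ s₀ μ ρ : ℝ} (h : WaveEstimate κ C t α₀ s₀ μ ρ)
    (hw : ∀ t x y, wave κ t (α + x) (s + y) μ ρ = wave κ t (α₀ + x) (s₀ + y) μ ρ) :
    WaveEstimate κ C t α s μ ρ := by
  have h0 : ∀ t, wave κ t α s μ ρ = wave κ t α₀ s₀ μ ρ := fun t => by
    simpa using hw t 0 0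
  refine ⟨?_, by rw [h0]; exact h.bound, ?_⟩
  · have e : (fun q : ℝ × ℝ × ℝ => wave κ q.1 q.2.1 q.2.2 μ ρ) =
        fun q => wave κ q.1 (α₀ + (q.2.1 - α)) (s₀ + (q.2.2 - s)) μ ρ := by
      funext q
      rw [← hw, add_sub_cancel, add_sub_cancel]
    rw [e]
    refine ContDiffAt.comp (g := fun q : ℝ × ℝ × ℝ => wave κ q.1 q.2.1 q.2.2 μ ρ)
      (f := fun q : ℝ × ℝ × ℝ => (q.1, α₀ + (q.2.1 - α), s₀ + (q.2.2 - s))) (t, α, s) ?_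
      (by fun_prop)
    simpa using h.smooth
  · simp only [h0, hw]
    exact h.jets

theorem exists_waveEstimate {κ : ℝ} (hκ : 0 < κ) : ∃ μ₀ > 0, ∃ C > 0, ∀ μ ρ : ℝ, 0 < μ → μ ≤ μ₀ →
    1 / 2 ≤ ρ → ρ ≤ 7 / 2 → ∀ t, 0 ≤ t → t ≤ 4 → ∀ α s, WaveEstimate κ C t α s μ ρ := by
  obtain ⟨μ₁, hμ₁, hG⟩ := exists_waveGram_pos κ
  obtain ⟨M, hM, hb⟩ := exists_waveBound hG
  refine ⟨min μ₁ (1 / (7 * (M ^ 2 + 1))), by positivity,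
    3 * M + 2 * ((47 + M + 5 * κ ^ 2 + κ) * M ^ 2), by positivity, ?_⟩
  intro μ ρ hμ hμ' hρ hρ' t ht0 ht4 α s
  obtain ⟨α₀, hα₀, s₀, hs₀, hw⟩ := exists_wave_translate κ α s μ ρ
  have h1 : μ ≤ μ₁ := hμ'.trans (min_le_left _ _)
  exact (waveEstimate_of_waveBound hκ hM (hb μ hμ.le h1 t ⟨ht0, ht4⟩ α₀ hα₀ s₀ hs₀ ρ ⟨hρ, hρ'⟩)
    (hG μ hμ.le h1 t ⟨ht0, ht4⟩ α₀ hα₀ s₀ hs₀ ρ ⟨hρ, hρ'⟩) hμ (hμ'.trans (min_le_right _ _))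
    hρ hρ' ht0 ht4).translate hw

/-- The local frequency at height `w`. -/
noncomputable def freq (κ ν₀ w : ℝ) : ℝ := (ν₀ ^ 3 + 3 / 2 * κ * w) ^ ((1 : ℝ) / 3)

/-- The decaying weight at height `w`. -/
noncomputable def weight (κ ν₀ w : ℝ) : ℝ :=
  Real.exp (-freq κ ν₀ w ^ 4 / (2 * κ)) * √(freq κ ν₀ w)

section

variable {κ ν₀ w : ℝ}

lemma freq_pos (h : 0 < ν₀ ^ 3 + 3 / 2 * κ * w) : 0 < freq κ ν₀ w := Real.rpow_pos_of_pos h _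

lemma eventually_freq_base_pos (h : 0 < ν₀ ^ 3 + 3 / 2 * κ * w) :
    ∀ᶠ τ in 𝓝 w, 0 < ν₀ ^ 3 + 3 / 2 * κ * τ :=
  (isOpen_lt continuous_const (by fun_prop)).mem_nhds h

lemma hasDerivAt_freq (h : 0 < ν₀ ^ 3 + 3 / 2 * κ * w) :
    HasDerivAt (freq κ ν₀) (κ / (2 * freq κ ν₀ w ^ 2)) w := by
  have h1 : HasDerivAt (fun w => ν₀ ^ 3 + 3 / 2 * κ * w) (3 / 2 * κ) w := by
    simpa using ((hasDerivAt_id w).const_mul (3 / 2 * κ)).const_add (ν₀ ^ 3)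
  refine (h1.rpow_const (p := (1 : ℝ) / 3) (Or.inl h.ne')).congr_deriv ?_
  rw [freq]
  generalize ν₀ ^ 3 + 3 / 2 * κ * w = b at *
  rw [← Real.rpow_natCast, ← Real.rpow_mul h.le,
    show (1 : ℝ) / 3 - 1 = -(1 / 3 * ((2 : ℕ) : ℝ)) by norm_num, Real.rpow_neg h.le]
  have := Real.rpow_pos_of_pos h (1 / 3 * ((2 : ℕ) : ℝ))
  field_simp

lemma contDiffAt_freq (h : 0 < ν₀ ^ 3 + 3 / 2 * κ * w) :
    ContDiffAt ℝ (⊤ : ℕ∞) (freq κ ν₀) w :=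
  ContDiffAt.rpow_const_of_ne (by fun_prop) h.ne'

lemma contDiffAt_weight (h : 0 < ν₀ ^ 3 + 3 / 2 * κ * w) :
    ContDiffAt ℝ (⊤ : ℕ∞) (weight κ ν₀) w := by
  have h1 := contDiffAt_freq h
  have h2 := h1.sqrt (freq_pos h).ne'
  have h3 : ContDiffAt ℝ (⊤ : ℕ∞) (fun w => Real.exp (-freq κ ν₀ w ^ 4 / (2 * κ))) w :=
    ((h1.pow 4).neg.div_const (2 * κ)).exp
  exact h3.mul h2

lemma hasTwoJetAt_freq_sq (h : 0 < ν₀ ^ 3 + 3 / 2 * κ * w) :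
    HasTwoJetAt (fun w => freq κ ν₀ w ^ 2) w (κ / freq κ ν₀ w)
      (-κ ^ 2 / (2 * freq κ ν₀ w ^ 4)) := by
  have hν := (freq_pos h).ne'
  refine ⟨fun τ => κ / freq κ ν₀ τ, ?_, rfl, ?_⟩
  · filter_upwards [eventually_freq_base_pos h] with τ hτ
    have hν := (freq_pos hτ).ne'
    refine ((hasDerivAt_freq hτ).pow 2).congr_deriv ?_
    field_simp
    norm_num
    ring
  · refine ((hasDerivAt_const w κ).div (hasDerivAt_freq h) hν).congr_deriv ?_
    field_simp
    ring

lemma hasDerivAt_weight (hκ : κ ≠ 0) (h : 0 < ν₀ ^ 3 + 3 / 2 * κ * w) :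
    HasDerivAt (weight κ ν₀)
      (weight κ ν₀ w * (-freq κ ν₀ w + κ / (4 * freq κ ν₀ w ^ 3))) w := by
  have hν := freq_pos h
  have h1 := hasDerivAt_freq h
  refine ((((h1.pow 4).neg.div_const (2 * κ)).exp.mul (h1.sqrt hν.ne'))).congr_deriv ?_
  have hs : √(freq κ ν₀ w) ^ 2 = freq κ ν₀ w := Real.sq_sqrt hν.le
  have hs0 : √(freq κ ν₀ w) ≠ 0 := (Real.sqrt_pos.2 hν).ne'
  simp only [weight, Pi.pow_apply, Pi.neg_apply]
  generalize Real.exp _ = e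
  generalize √(freq κ ν₀ w) = r at *
  rw [← hs]
  field_simp
  ring

lemma hasTwoJetAt_weight (hκ : κ ≠ 0) (h : 0 < ν₀ ^ 3 + 3 / 2 * κ * w) :
    HasTwoJetAt (weight κ ν₀) w
      (weight κ ν₀ w * (-freq κ ν₀ w + κ / (4 * freq κ ν₀ w ^ 3)))
      (weight κ ν₀ w * (freq κ ν₀ w ^ 2 - κ / freq κ ν₀ w ^ 2
        - 5 * κ ^ 2 / (16 * freq κ ν₀ w ^ 6))) := by
  refine ⟨fun w => weight κ ν₀ w * (-freq κ ν₀ w + κ / (4 * freq κ ν₀ w ^ 3)), ?_, rfl, ?_⟩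
  · filter_upwards [eventually_freq_base_pos h] with τ hτ using hasDerivAt_weight hκ hτ
  · have hν := (freq_pos h).ne'
    have h1 := hasDerivAt_freq h
    have h2 := h1.neg.add ((hasDerivAt_const w κ).div ((h1.pow 3).const_mul 4)
      (mul_ne_zero four_ne_zero (pow_ne_zero 3 hν)))
    refine ((hasDerivAt_weight hκ h).mul h2).congr_deriv ?_
    simp only [Pi.pow_apply, Pi.neg_apply, Pi.add_apply, Pi.div_apply]
    field_simp
    ring

lemma weight_pos (h : 0 < ν₀ ^ 3 + 3 / 2 * κ * w) : 0 < weight κ ν₀ w :=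
  mul_pos (Real.exp_pos _) (Real.sqrt_pos.2 (freq_pos h))

lemma hasTwoJetAt_weight_mul {j : ℝ → ℝ} {t u v : ℝ} (hκ : κ ≠ 0)
    (h : 0 < ν₀ ^ 3 + 3 / 2 * κ * w) (l : ℝ) (ht : freq κ ν₀ w ^ 2 - l = t)
    (hj : HasTwoJetAt (fun τ => j (t + τ)) 0 u v) :
    ∃ a, HasTwoJetAt (fun w => weight κ ν₀ w * j (freq κ ν₀ w ^ 2 - l)) w a
      (weight κ ν₀ w * ((freq κ ν₀ w ^ 2 - κ / freq κ ν₀ w ^ 2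
        - 5 * κ ^ 2 / (16 * freq κ ν₀ w ^ 6)) * j t - 2 * κ * u
        + κ ^ 2 / freq κ ν₀ w ^ 2 * v)) := by
  have hν := (freq_pos h).ne'
  have h1 : HasTwoJetAt (fun w => freq κ ν₀ w ^ 2 + (-l - t)) w _ _ :=
    (hasTwoJetAt_freq_sq h).add (HasTwoJetAt.const (-l - t))
  have h0 : (fun w => freq κ ν₀ w ^ 2 + (-l - t)) w = 0 := by
    beta_reduce; rw [← ht]; ring
  have h2 := HasTwoJetAt.comp (θ := fun w => freq κ ν₀ w ^ 2 + (-l - t)) (h0 ▸ hj) h1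
  have h3 := (hasTwoJetAt_weight hκ h).mul h2
  refine ⟨_, (h3.congr ?_).congr_jet rfl ?_⟩
  · exact Eventually.of_forall fun τ => by
      beta_reduce
      congr 2
      ring
  · beta_reduce at h0
    rw [h0, add_zero]
    field_simp
    ring

end

lemma weight_le {N ν₀ w : ℝ} (hN : 0 < N) (hν₀ : 0 < ν₀) (hw : 0 ≤ w) :
    weight (64 * N ^ 3) ν₀ w ≤
      (1 + 4 * (64 * N ^ 3)) * Real.exp (-N * w ^ ((4 : ℝ) / 3)) := by
  set κ := 64 * N ^ 3 with hκ
  have hκ0 : 0 < κ := by positivity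
  have hb : 0 < ν₀ ^ 3 + 3 / 2 * κ * w := by positivity
  have hν := freq_pos hb
  have h4 : freq κ ν₀ w ^ 4 = (ν₀ ^ 3 + 3 / 2 * κ * w) ^ ((4 : ℝ) / 3) := by
    rw [freq, ← Real.rpow_natCast, ← Real.rpow_mul hb.le]; norm_num
  have hκ4 : κ ^ ((4 : ℝ) / 3) = 4 * κ * N := by
    have : κ = (4 * N) ^ (3 : ℝ) := by
      rw [hκ]; norm_cast; ring
    rw [this, ← Real.rpow_mul (by positivity)]
    norm_num
    norm_cast
    ring
  have hlow : 4 * κ * (N * w ^ ((4 : ℝ) / 3)) ≤ freq κ ν₀ w ^ 4 := by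
    rw [h4, ← mul_assoc, ← hκ4, ← Real.mul_rpow hκ0.le hw]
    refine Real.rpow_le_rpow (by positivity) ?_ (by norm_num)
    nlinarith [pow_pos hν₀ 3, mul_nonneg hκ0.le hw]
  set u := freq κ ν₀ w ^ 4 / (4 * κ) with hu
  have hu0 : 0 ≤ u := by positivity
  have hNu : N * w ^ ((4 : ℝ) / 3) ≤ u := by
    rw [hu, le_div_iff₀ (by positivity)]; linarith
  have hsq : √(freq κ ν₀ w) ≤ (1 + 4 * κ) * Real.exp u := by
    have e1 : √(freq κ ν₀ w) ≤ 1 + freq κ ν₀ w ^ 4 := by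
      rw [Real.sqrt_le_left (by positivity)]
      nlinarith [sq_nonneg (freq κ ν₀ w - 1), sq_nonneg (freq κ ν₀ w ^ 2 - 1),
        pow_pos hν 4, pow_pos hν 8, sq_nonneg (freq κ ν₀ w)]
    have e2 : freq κ ν₀ w ^ 4 = 4 * κ * u := by rw [hu]; field_simp
    have e3 := Real.add_one_le_exp u
    rw [e2] at e1
    nlinarith [mul_nonneg hκ0.le hu0]
  have e : -freq κ ν₀ w ^ 4 / (2 * κ) = -u + -u := by
    rw [hu]; field_simp; norm_num
  calc weight κ ν₀ w = Real.exp (-u) * (Real.exp (-u) * √(freq κ ν₀ w)) := by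
        rw [weight, e, Real.exp_add]; ring
    _ ≤ Real.exp (-u) * (Real.exp (-u) * ((1 + 4 * κ) * Real.exp u)) := by gcongr
    _ = (1 + 4 * κ) * Real.exp (-u) * (Real.exp (-u) * Real.exp u) := by ring
    _ = (1 + 4 * κ) * Real.exp (-u) := by rw [← Real.exp_add]; simp
    _ ≤ _ := by
        gcongr
        linarith

lemma exists_lattice_frequencies {d : ℕ} (hd : 3 ≤ d) (m : ℕ) (hm : m % 4 = 2) (hm' : 22 ≤ m) :
    ∃ ξ : ℕ → Fin d → ℤ, (∀ k, ∑ i, (ξ k i : ℝ) ^ 2 = m + 4 * k) ∧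
      ∀ k : ℕ, ((m : ℝ) + 4 * k) / 2 ≤ ∑ i, ((ξ (k + 1) i : ℝ) - ξ k i) ^ 2 ∧
        ∑ i, ((ξ (k + 1) i : ℝ) - ξ k i) ^ 2 ≤ 7 / 2 * ((m : ℝ) + 4 * k) := by
  obtain ⟨ζ, h1, h2⟩ := exists_frequencies m hm
  obtain ⟨n, rfl⟩ : ∃ n, d = n + 3 := ⟨d - 3, by omega⟩
  have hsum : ∀ x y z : ℝ, ∀ f : Fin (n + 3) → ℝ, f 0 = x → f 1 = y → f 2 = z →
      (∀ i : Fin n, f i.succ.succ.succ = 0) → ∑ i, f i = x + y + z := by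
    intro x y z f hx hy hz h
    rw [Fin.sum_univ_succ, Fin.sum_univ_succ, Fin.sum_univ_succ, Finset.sum_eq_zero fun i _ => h i]
    rw [← hx, ← hy, ← hz]
    simp only [add_zero, add_assoc]
    rfl
  let ξ : ℕ → Fin (n + 3) → ℤ := fun k =>
    Fin.cons (ζ k).1 (Fin.cons (ζ k).2.1 (Fin.cons (ζ k).2.2 fun _ => 0))
  have x0 : ∀ k, ξ k 0 = (ζ k).1 := fun k => rfl
  have x1 : ∀ k, ξ k 1 = (ζ k).2.1 := fun k => rfl
  have x2 : ∀ k, ξ k 2 = (ζ k).2.2 := fun k => rfl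
  have x3 : ∀ k (i : Fin n), ξ k i.succ.succ.succ = 0 := fun k i => rfl
  refine ⟨ξ, fun k => ?_, fun k => ?_⟩
  · rw [hsum _ _ _ (fun i => (ξ k i : ℝ) ^ 2) rfl rfl rfl (fun i => by simp [x3])]
    rw [x0, x1, x2]
    exact_mod_cast h1 k
  · rw [hsum _ _ _ (fun i => ((ξ (k + 1) i : ℝ) - ξ k i) ^ 2) rfl rfl rfl (fun i => by simp [x3])]
    rw [x0, x1, x2, x0, x1, x2]
    have a := h1 k
    have b := h1 (k + 1)
    have c := h2 k
    rify at a b c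
    generalize ζ k = u at *
    generalize ζ (k + 1) = v at *
    obtain ⟨x, y, z⟩ := u
    obtain ⟨x', y', z'⟩ := v
    dsimp only at a b c ⊢
    have hl : (22 : ℝ) ≤ (m : ℝ) + 4 * k := by
      have : (22 : ℝ) ≤ m := by exact_mod_cast hm'
      linarith [Nat.cast_nonneg (α := ℝ) k]
    have hP := abs_le_of_sq_le_sq' (a := (x : ℝ) * x' + y * y' + z * z')
      (b := 3 / 5 * ((m : ℝ) + 4 * k + 2)) (by nlinarith) (by linarith)
    constructor <;> linarith

/-- The phase of the plane wave with integer frequency `ξ`. -/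
noncomputable def latticePhase {d : ℕ} (ξ : Fin d → ℤ) (y : Fin d → ℝ) : ℝ := ∑ i, (ξ i : ℝ) * y i

/-- The squared distance between consecutive frequencies. -/
noncomputable def gapSq {d : ℕ} (ξ : ℕ → Fin d → ℤ) (k : ℕ) : ℝ :=
  ∑ i, ((ξ (k + 1) i : ℝ) - ξ k i) ^ 2

/-- The transition between the `k`-th and the `(k+1)`-st plane wave, at energy `z`. -/
noncomputable def transition {d : ℕ} (κ m : ℝ) (ξ : ℕ → Fin d → ℤ) (k : ℕ) (z : ℝ)
    (y : Fin d → ℝ) : ℝ :=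
  wave κ (z - (m + 4 * k)) (latticePhase (ξ k) y)
    (latticePhase (ξ (k + 1)) y - latticePhase (ξ k) y)
    (1 / gapSq ξ k) (gapSq ξ k / (m + 4 * k))

section

variable {d : ℕ} {κ m : ℝ} {ξ : ℕ → Fin d → ℤ}

lemma transition_eq_succ {k : ℕ} {z : ℝ} (h : 15 / 4 < z - (m + 4 * k))
    (h' : z - (m + 4 * k) < 17 / 4) (y : Fin d → ℝ) :
    transition κ m ξ k z y = transition κ m ξ (k + 1) z y := by
  rw [transition, wave_of_gt h, transition, wave_of_lt (by push_cast; linarith)]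
  congr 1
  ring

lemma exists_transition_eventuallyEq {z₀ : ℝ} (hz : m ≤ z₀) : ∃ k : ℕ, 0 ≤ z₀ - (m + 4 * k) ∧
    z₀ - (m + 4 * k) ≤ 4 ∧ ∀ᶠ z in 𝓝 z₀, ∀ y : Fin d → ℝ,
      transition κ m ξ ⌊(z - m) / 4⌋₊ z y = transition κ m ξ k z y := by
  have h0 : 0 ≤ (z₀ - m) / 4 := by linarith
  have h1 := Nat.floor_le h0
  have h2 := Nat.lt_floor_add_one ((z₀ - m) / 4)
  generalize ⌊(z₀ - m) / 4⌋₊ = k at h1 h2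
  refine ⟨k, by linarith, by linarith, ?_⟩
  have e1 : ∀ᶠ z in 𝓝 z₀, m + 4 * k - 1 / 4 < z := lt_mem_nhds (by linarith)
  have e2 : ∀ᶠ z in 𝓝 z₀, z < m + 4 * k + 4 := gt_mem_nhds (by linarith)
  filter_upwards [e1, e2] with z hz1 hz2 y
  rcases le_or_gt (m + 4 * k) z with hk | hk
  · rw [(Nat.floor_eq_iff (by linarith [Nat.cast_nonneg (α := ℝ) k])).2
      (⟨by linarith, by linarith⟩ : (k : ℝ) ≤ (z - m) / 4 ∧ (z - m) / 4 < k + 1)]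
  · cases k with
    | zero => rw [Nat.floor_of_nonpos (by norm_num at hk; linarith)]
    | succ j =>
      push_cast at hk hz1 hz2
      rw [(Nat.floor_eq_iff (by linarith [Nat.cast_nonneg (α := ℝ) j])).2
        (⟨by linarith, by linarith⟩ : (j : ℝ) ≤ (z - m) / 4 ∧ (z - m) / 4 < j + 1)]
      exact transition_eq_succ (by linarith) (by linarith) y

lemma latticePhase_update (ξ : Fin d → ℤ) (y : Fin d → ℝ) (i : Fin d) (τ : ℝ) :
    latticePhase ξ (Function.update y i τ) = latticePhase ξ y + ξ i * (τ - y i) := by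
  have h : ∀ j, (ξ j : ℝ) * Function.update y i τ j
      = ξ j * y j + if j = i then ξ i * (τ - y i) else 0 := by
    intro j
    split_ifs with hj
    · subst hj; simp; ring
    · simp [hj]
  simp only [latticePhase, h, Finset.sum_add_distrib, Finset.sum_ite_eq', Finset.mem_univ, if_true]

lemma transition_periodic (k : ℕ) (z : ℝ) (y : Fin d → ℝ) (i : Fin d) :
    transition κ m ξ k z (Function.update y i (y i + 2 * π)) = transition κ m ξ k z y := by
  have h1 : ∀ (t s μ ρ : ℝ), Function.Periodic (fun α => wave κ t α s μ ρ) (2 * π) :=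
    fun t s μ ρ α => wave_add_left κ t α s μ ρ
  have h2 : ∀ (t α μ ρ : ℝ), Function.Periodic (fun s => wave κ t α s μ ρ) (2 * π) :=
    fun t α μ ρ s => wave_add_right κ t α s μ ρ
  simp only [transition, latticePhase_update, add_sub_cancel_left]
  refine ((h1 _ _ _ _).int_mul (ξ k i) _).trans ?_
  rw [show ∀ a b : ℝ, a + ξ (k + 1) i * (2 * π) -
    (b + ξ k i * (2 * π)) = a - b + ((ξ (k + 1) i - ξ k i : ℤ) : ℝ) * (2 * π) by
      intro a b; push_cast; ring]
  exact (h2 _ _ _ _).int_mul (ξ (k + 1) i - ξ k i) _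

end

section

variable {d : ℕ} {κ m ν₀ C : ℝ} {ξ : ℕ → Fin d → ℤ} {k : ℕ}

/-- The `k`-th piece of the solution. -/
noncomputable def piece (κ ν₀ m : ℝ) (ξ : ℕ → Fin d → ℤ) (k : ℕ) (p : ℝ × (Fin d → ℝ)) : ℝ :=
  weight κ ν₀ p.1 * transition κ m ξ k (freq κ ν₀ p.1 ^ 2) p.2

/-- The parameters of the `k`-th transition satisfy the local estimate at energy `z`. -/
def TransitionEstimate (κ C m : ℝ) (ξ : ℕ → Fin d → ℤ) (k : ℕ) (z : ℝ) : Prop :=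
  ∀ α s, WaveEstimate κ C (z - (m + 4 * k)) α s (1 / gapSq ξ k) (gapSq ξ k / (m + 4 * k))

lemma contDiff_latticePhase (η : Fin d → ℤ) : ContDiff ℝ (⊤ : ℕ∞) (latticePhase η) := by
  unfold latticePhase
  fun_prop

lemma contDiffAt_piece {p : ℝ × (Fin d → ℝ)} (h : 0 < ν₀ ^ 3 + 3 / 2 * κ * p.1)
    (hw : TransitionEstimate κ C m ξ k (freq κ ν₀ p.1 ^ 2)) :
    ContDiffAt ℝ (⊤ : ℕ∞) (piece κ ν₀ m ξ k) p := by
  have h1 : ContDiffAt ℝ (⊤ : ℕ∞) (fun p : ℝ × (Fin d → ℝ) => weight κ ν₀ p.1) p :=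
    (contDiffAt_weight h).comp p contDiffAt_fst
  have h2 : ContDiffAt ℝ (⊤ : ℕ∞) (fun p : ℝ × (Fin d → ℝ) => freq κ ν₀ p.1) p :=
    (contDiffAt_freq h).comp p contDiffAt_fst
  have h3 : ∀ η : Fin d → ℤ,
      ContDiffAt ℝ (⊤ : ℕ∞) (fun p : ℝ × (Fin d → ℝ) => latticePhase η p.2) p :=
    fun η => (contDiff_latticePhase η).contDiffAt.comp p contDiffAt_snd
  refine h1.mul (ContDiffAt.comp (g := fun q : ℝ × ℝ × ℝ => wave κ q.1 q.2.1 q.2.2 _ _)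
    (f := fun p : ℝ × (Fin d → ℝ) => (freq κ ν₀ p.1 ^ 2 - (m + 4 * k), latticePhase (ξ k) p.2,
      latticePhase (ξ (k + 1)) p.2 - latticePhase (ξ k) p.2)) p (hw _ _).smooth ?_)
  exact ((h2.pow 2).sub contDiffAt_const).prodMk ((h3 _).prodMk ((h3 _).sub (h3 _)))

lemma piece_laplacian (hκ : 0 < κ) (hm : 1 ≤ m) (hξ : ∀ k, ∑ i, (ξ k i : ℝ) ^ 2 = m + 4 * k)
    (hgap : gapSq ξ k ≠ 0) {p : ℝ × (Fin d → ℝ)} (h : 0 < ν₀ ^ 3 + 3 / 2 * κ * p.1)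
    (hz : 1 ≤ freq κ ν₀ p.1 ^ 2) (hw : TransitionEstimate κ C m ξ k (freq κ ν₀ p.1 ^ 2)) :
    ∃ a A : ℝ, ∃ b B : Fin d → ℝ,
      HasTwoJetAt (fun τ => piece κ ν₀ m ξ k (τ, p.2)) p.1 a A ∧
      (∀ i, HasTwoJetAt (fun τ => piece κ ν₀ m ξ k (p.1, Function.update p.2 i τ)) (p.2 i)
        (b i) (B i)) ∧
      |A + ∑ i, B i| ≤ (C + κ + κ ^ 2) * |piece κ ν₀ m ξ k p| := by
  obtain ⟨w, y⟩ := p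
  dsimp only at h hz hw ⊢
  obtain ⟨u, v, hj, hjets⟩ := (hw (latticePhase (ξ k) y)
    (latticePhase (ξ (k + 1)) y - latticePhase (ξ k) y)).jets
  have hl : 0 < m + 4 * k := by positivity
  have e : 1 / (1 / gapSq ξ k * (gapSq ξ k / (m + 4 * k))) = m + 4 * k := by field_simp
  have hcross : ∑ i, (ξ k i : ℝ) * ((ξ (k + 1) i : ℝ) - ξ k i) = (4 - gapSq ξ k) / 2 := by
    have h1 := hξ (k + 1)
    have h0 := hξ k
    have : gapSq ξ k = ∑ i, (ξ (k + 1) i : ℝ) ^ 2 - ∑ i, (ξ k i : ℝ) ^ 2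
        - 2 * ∑ i, (ξ k i : ℝ) * ((ξ (k + 1) i : ℝ) - ξ k i) := by
      rw [gapSq, Finset.mul_sum, ← Finset.sum_sub_distrib, ← Finset.sum_sub_distrib]
      exact Finset.sum_congr rfl fun i _ => by ring
    rw [h1, h0] at this
    push_cast at this
    linarith
  obtain ⟨a, b, hb, hest⟩ := hjets (fun i => (ξ k i : ℝ)) (fun i => (ξ (k + 1) i : ℝ) - ξ k i)
    (by rw [e, hξ]) (by rw [hcross, one_div_one_div]) (by rw [one_div_one_div, gapSq])
  obtain ⟨a₀, ha₀⟩ := hasTwoJetAt_weight_mul hκ.ne' h (m + 4 * k) rfl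
    (j := fun t => wave κ t (latticePhase (ξ k) y)
      (latticePhase (ξ (k + 1)) y - latticePhase (ξ k) y) (1 / gapSq ξ k)
      (gapSq ξ k / (m + 4 * k))) hj
  refine ⟨a₀, _, fun i => weight κ ν₀ w * a i, fun i => weight κ ν₀ w * b i, ha₀, fun i => ?_, ?_⟩
  · have h0 : HasTwoJetAt (fun τ : ℝ => -y i + 1 * τ) (y i) 1 0 := HasTwoJetAt.linear _ _
    have h1 := HasTwoJetAt.comp (θ := fun τ : ℝ => -y i + 1 * τ) (x := y i)
      (by simpa using hb i) h0
    refine ((h1.const_mul (weight κ ν₀ w)).congr (Eventually.of_forall fun τ => ?_)).congr_jet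
      (by ring) (by ring)
    simp only [piece, transition, latticePhase_update]
    congr 2 <;> ring
  · have hW := weight_pos h
    simp only [piece, transition]
    rw [e] at hest
    set J := wave κ (freq κ ν₀ w ^ 2 - (m + 4 * k)) (latticePhase (ξ k) y)
      (latticePhase (ξ (k + 1)) y - latticePhase (ξ k) y) (1 / gapSq ξ k)
      (gapSq ξ k / (m + 4 * k)) with hJ
    rw [sub_add_cancel] at hest
    have hν := freq_pos h
    set T := freq κ ν₀ w ^ 2 with hT
    have hT6 : freq κ ν₀ w ^ 6 = T ^ 3 := by rw [hT]; ring
    rw [hT6, ← Finset.mul_sum, ← mul_add, abs_mul, abs_mul, abs_of_pos hW, mul_left_comm]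
    refine mul_le_mul_of_nonneg_left ?_ hW.le
    have b1 : |κ / T| ≤ κ := by
      rw [abs_of_pos (by positivity)]
      exact div_le_self hκ.le hz
    have b2 : |5 * κ ^ 2 / (16 * T ^ 3)| ≤ κ ^ 2 := by
      rw [abs_of_pos (by positivity), div_le_iff₀ (by positivity)]
      nlinarith [one_le_pow₀ hz (n := 3), sq_nonneg κ]
    calc _ = |(T * J - 2 * κ * u + κ ^ 2 / T * v + ∑ i, b i)
          + (-(κ / T * J) + -(5 * κ ^ 2 / (16 * T ^ 3) * J))| := by congr 1; ring
      _ ≤ C * |J| + (κ * |J| + κ ^ 2 * |J|) := by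
        refine (abs_add_le _ _).trans (add_le_add hest ((abs_add_le _ _).trans ?_))
        rw [abs_neg, abs_neg, abs_mul, abs_mul]
        gcongr
      _ = _ := by ring

end

section

variable {d : ℕ} {κ m ν₀ C : ℝ} {ξ : ℕ → Fin d → ℤ}

/-- The solution, glued from the pieces. -/
noncomputable def glued (κ ν₀ m : ℝ) (ξ : ℕ → Fin d → ℤ) (p : ℝ × (Fin d → ℝ)) : ℝ :=
  piece κ ν₀ m ξ ⌊(freq κ ν₀ p.1 ^ 2 - m) / 4⌋₊ p

lemma freq_zero (hν₀ : 0 ≤ ν₀) : freq κ ν₀ 0 = ν₀ := by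
  rw [freq, mul_zero, add_zero, one_div]
  exact Real.pow_rpow_inv_natCast hν₀ three_ne_zero

lemma le_freq (hκ : 0 ≤ κ) (hν₀ : 0 ≤ ν₀) {w : ℝ} (hw : 0 ≤ w) : ν₀ ≤ freq κ ν₀ w := by
  conv_lhs => rw [← freq_zero (κ := κ) hν₀]
  refine Real.rpow_le_rpow (by positivity) ?_ (by norm_num)
  gcongr

lemma exists_glued_eventuallyEq {w : ℝ} (h : 0 < ν₀ ^ 3 + 3 / 2 * κ * w)
    (hm : m ≤ freq κ ν₀ w ^ 2) : ∃ k : ℕ, 0 ≤ freq κ ν₀ w ^ 2 - (m + 4 * k) ∧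
      freq κ ν₀ w ^ 2 - (m + 4 * k) ≤ 4 ∧
      ∀ᶠ τ in 𝓝 w, ∀ y, glued κ ν₀ m ξ (τ, y) = piece κ ν₀ m ξ k (τ, y) := by
  obtain ⟨k, h0, h4, hk⟩ := exists_transition_eventuallyEq (κ := κ) (ξ := ξ) hm
  refine ⟨k, h0, h4, ?_⟩
  have hc : ContinuousAt (fun τ => freq κ ν₀ τ ^ 2) w := (contDiffAt_freq h).continuousAt.pow 2
  filter_upwards [hc.eventually hk] with τ hτ y
  simp only [glued, piece, hτ y]

lemma abs_cylLaplacian_glued_le (hκ : 0 < κ) (hm : 1 ≤ m)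
    (hξ : ∀ k, ∑ i, (ξ k i : ℝ) ^ 2 = m + 4 * k) {k : ℕ} (hgap : gapSq ξ k ≠ 0)
    {p : ℝ × (Fin d → ℝ)} (h : 0 < ν₀ ^ 3 + 3 / 2 * κ * p.1)
    (hz : 1 ≤ freq κ ν₀ p.1 ^ 2) (hw : TransitionEstimate κ C m ξ k (freq κ ν₀ p.1 ^ 2))
    (he : ∀ᶠ τ in 𝓝 p.1, ∀ y, glued κ ν₀ m ξ (τ, y) = piece κ ν₀ m ξ k (τ, y)) :
    |cylLaplacian d (glued κ ν₀ m ξ) p| ≤ (C + κ + κ ^ 2) * |glued κ ν₀ m ξ p| := by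
  obtain ⟨a, A, b, B, h1, h2, h3⟩ := piece_laplacian hκ hm hξ hgap h hz hw
  have e1 := (h1.congr (he.mono fun τ hτ => hτ p.2)).deriv_deriv_eq
  have e2 := fun i => ((h2 i).congr
    (Eventually.of_forall fun τ => he.self_of_nhds (Function.update p.2 i τ))).deriv_deriv_eq
  rw [cylLaplacian, e1, Finset.sum_congr rfl fun i _ => e2 i,
    show glued κ ν₀ m ξ p = piece κ ν₀ m ξ k p from he.self_of_nhds p.2]
  exact h3

end

/-- **Theorem (main result).** Let `d ≥ 3` and `N > 0`. There exist `C > 0` and a real-valued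
function `F ∈ C^∞([0,∞) × T^d)`, not identically zero, with `|ΔF(x)| ≤ C|F(x)|` and
`|F(x)| ≤ C e^{-N w^{4/3}}` for all `x = (w,y) ∈ [0,∞) × T^d`. -/
theorem statement0 (d : ℕ) (hd : 3 ≤ d) (N : ℝ) (hN : 0 < N) :
    ∃ (C : ℝ) (F : ℝ × (Fin d → ℝ) → ℝ), 0 < C ∧
      ContDiffOn ℝ (⊤ : ℕ∞) F {p : ℝ × (Fin d → ℝ) | 0 ≤ p.1} ∧
      cylPeriodic d F ∧
      (∃ p : ℝ × (Fin d → ℝ), 0 ≤ p.1 ∧ F p ≠ 0) ∧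
      (∀ p : ℝ × (Fin d → ℝ), 0 ≤ p.1 →
        |cylLaplacian d F p| ≤ C * |F p|) ∧
      (∀ p : ℝ × (Fin d → ℝ), 0 ≤ p.1 →
        |F p| ≤ C * Real.exp (-N * p.1 ^ ((4 : ℝ) / 3))) := by
  set κ : ℝ := 64 * N ^ 3 with hκ
  have hκ0 : 0 < κ := by positivity
  obtain ⟨μ₀, hμ₀, C, hC, hest⟩ := exists_waveEstimate hκ0
  obtain ⟨n, hn⟩ := exists_nat_gt (2 / μ₀)
  set M : ℕ := 4 * n + 22 with hM
  obtain ⟨ξ, hξ, hgap⟩ := exists_lattice_frequencies hd M (by omega) (by omega)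
  have hMn : (M : ℝ) = 4 * n + 22 := by rw [hM]; push_cast; ring
  have hM1 : (1 : ℝ) ≤ M := by rw [hMn]; linarith [Nat.cast_nonneg (α := ℝ) n]
  have hMμ : 2 / μ₀ ≤ M := by rw [hMn]; linarith [Nat.cast_nonneg (α := ℝ) n]
  have hgap0 : ∀ k, 0 < gapSq ξ k := fun k => lt_of_lt_of_le (by positivity) (hgap k).1
  have htrans : ∀ (k : ℕ) (z : ℝ), 0 ≤ z - ((M : ℝ) + 4 * k) → z - ((M : ℝ) + 4 * k) ≤ 4 →
      TransitionEstimate κ C M ξ k z := by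
    intro k z h0 h4 α s
    have hl : (0 : ℝ) < (M : ℝ) + 4 * k := by positivity
    refine hest _ _ (one_div_pos.2 (hgap0 k)) ?_ ?_ ?_ _ h0 h4 α s
    · rw [one_div_le (hgap0 k) hμ₀]
      refine le_trans ?_ (hgap k).1
      rw [div_le_iff₀ hμ₀] at hMμ
      rw [div_le_div_iff₀ hμ₀ two_pos]
      nlinarith [mul_nonneg (Nat.cast_nonneg (α := ℝ) k) hμ₀.le]
    · rw [le_div_iff₀ hl]; exact (hgap k).1.trans' (by linarith)
    · rw [div_le_iff₀ hl]; exact (hgap k).2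
  set ν₀ : ℝ := √M with hν₀
  have hν0 : 0 < ν₀ := Real.sqrt_pos.2 (by linarith)
  have hνM : ν₀ ^ 2 = M := Real.sq_sqrt (by linarith)
  have hbase : ∀ w : ℝ, 0 ≤ w → 0 < ν₀ ^ 3 + 3 / 2 * κ * w := fun w hw => by positivity
  have hfreq : ∀ w : ℝ, 0 ≤ w → (M : ℝ) ≤ freq κ ν₀ w ^ 2 := fun w hw => by
    rw [← hνM]
    exact pow_le_pow_left₀ hν0.le (le_freq hκ0.le hν0.le hw) 2
  refine ⟨C + κ + κ ^ 2 + C * (1 + 4 * κ), glued κ ν₀ M ξ, by positivity, ?_, ?_,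
    ⟨(0, 0), le_rfl, ?_⟩, ?_, ?_⟩
  · intro p hp
    obtain ⟨k, h0, h4, he⟩ := exists_glued_eventuallyEq (ξ := ξ) (hbase p.1 hp) (hfreq p.1 hp)
    refine ((contDiffAt_piece (hbase p.1 hp) (htrans k _ h0 h4)).congr_of_eventuallyEq
      ?_).contDiffWithinAt
    filter_upwards [continuousAt_fst.eventually he] with q hq using hq q.2
  · intro p i
    simp only [glued, piece, transition_periodic]
  · simp only [glued, piece, freq_zero hν0.le, hνM, sub_self, zero_div, Nat.floor_zero, transition]
    rw [wave_of_lt (by norm_num)]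
    simpa [latticePhase] using (weight_pos (hbase 0 le_rfl)).ne'
  · intro p hp
    obtain ⟨k, h0, h4, he⟩ := exists_glued_eventuallyEq (ξ := ξ) (hbase p.1 hp) (hfreq p.1 hp)
    refine (abs_cylLaplacian_glued_le hκ0 hM1 hξ (hgap0 k).ne' (hbase p.1 hp)
      (hM1.trans (hfreq p.1 hp)) (htrans k _ h0 h4) he).trans ?_
    exact mul_le_mul_of_nonneg_right (le_add_of_nonneg_right (by positivity)) (abs_nonneg _)
  · intro p hp
    obtain ⟨k, h0, h4, he⟩ := exists_glued_eventuallyEq (ξ := ξ) (hbase p.1 hp) (hfreq p.1 hp)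
    have hW := weight_pos (hbase p.1 hp)
    have hJ := (htrans k _ h0 h4 (latticePhase (ξ k) p.2)
      (latticePhase (ξ (k + 1)) p.2 - latticePhase (ξ k) p.2)).bound
    rw [show glued κ ν₀ M ξ p = piece κ ν₀ M ξ k p from he.self_of_nhds p.2, piece, abs_mul,
      abs_of_pos hW]
    calc _ ≤ (1 + 4 * κ) * Real.exp (-N * p.1 ^ ((4 : ℝ) / 3)) * C :=
          mul_le_mul (weight_le hN hν0 hp) hJ (abs_nonneg _) (by positivity)
      _ = C * (1 + 4 * κ) * Real.exp (-N * p.1 ^ ((4 : ℝ) / 3)) := by ring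
      _ ≤ _ := by
        gcongr
        exact le_add_of_nonneg_left (by positivity)
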